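/- (Compactness, Theorem 1.1, with the BV regularity of the limit omitted.) Assume W is continuous and satisfies (H1) and (H2). Let ω ⊂ ℝ² be a nonempty bounded convex open set, Ω := ω × I. Let h_n → 0⁺ and ε_n → 0⁺ be arbitrary sequences and let u_n : Ω → ℝ³ be C² maps with sup_n F^{h_n}_{ε_n}(u_n, Ω) < ∞. Then there exist a subsequence (not relabeled), a measurable set E ⊆ ω, and a Lipschitz map u : Ω → ℝ³ with u(x', x₃) independent of x₃, such that, setting M(x') := A for x' ∉ E and M(x') := B for x' ∈ E: (a) (∂₁u, ∂₂u)(x) equals the first two columns of M(x') for a.e. x = (x', x₃) ∈ Ω; (b) ∫_Ω |∇_{h_n}u_n(x) − M(x')|^p dx → 0; (c) ∫_Ω |u_n(x) − (1/|Ω|)∫_Ω u_n dy − u(x)|^p dx → 0. -/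

import Mathlib

open MeasureTheory Filter Topology ENNReal NNReal Set

noncomputable section

/-- Vectors in ℝ³. -/
abbrev V3 := Fin 3 → ℝ

/-- 3×3 matrices, represented as the triple of their columns. -/
abbrev M33 := Fin 3 → V3

/-- Euclidean norm on ℝ³. -/
def vnorm (v : V3) : ℝ := Real.sqrt (∑ i, (v i) ^ 2)

/-- Frobenius (Euclidean) norm on 3×3 matrices. -/
def mnorm (ξ : M33) : ℝ := Real.sqrt (∑ j, ∑ i, (ξ j i) ^ 2)

/-- dist(ξ,{A,B}). -/
def mdist (A B ξ : M33) : ℝ := min (mnorm (ξ - A)) (mnorm (ξ - B))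

/-- Spatial points of ℝ³ = ℝ × ℝ × ℝ. -/
abbrev Pt := ℝ × ℝ × ℝ

/-- Directional partial derivative of a map `u : ℝ³ → ℝ³`. -/
def pd (e : Pt) (u : Pt → V3) (x : Pt) : V3 := fderiv ℝ u x e

def e1 : Pt := (1, 0, 0)
def e2 : Pt := (0, 1, 0)
def e3 : Pt := (0, 0, 1)

/-- Rescaled gradient ∇_h u = (∂₁u, ∂₂u, h⁻¹ ∂₃u), as a 3×3 matrix of columns. -/
def gradh (h : ℝ) (u : Pt → V3) (x : Pt) : M33 :=
  ![pd e1 u x, pd e2 u x, h⁻¹ • pd e3 u x]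

/-- Squared rescaled Hessian |∇²_h u|². -/
def hessh (h : ℝ) (u : Pt → V3) (x : Pt) : ℝ :=
  (vnorm (pd e1 (pd e1 u) x)) ^ 2 + (vnorm (pd e2 (pd e2 u) x)) ^ 2
    + (h⁻¹) ^ 4 * (vnorm (pd e3 (pd e3 u) x)) ^ 2
    + 2 * (vnorm (pd e2 (pd e1 u) x)) ^ 2
    + 2 * (h⁻¹) ^ 2 * (vnorm (pd e3 (pd e1 u) x)) ^ 2
    + 2 * (h⁻¹) ^ 2 * (vnorm (pd e3 (pd e2 u) x)) ^ 2

/-- The energy F^h_ε(u, S) = ∫_S (1/ε) W(∇_h u) + ε |∇²_h u|², valued in [0,∞]. -/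
def F (W : M33 → ℝ) (h ε : ℝ) (u : Pt → V3) (S : Set Pt) : ℝ≥0∞ :=
  ∫⁻ x in S, ENNReal.ofReal (ε⁻¹ * W (gradh h u x) + ε * hessh h u x)

/-- Hypothesis (H1): W ≥ 0, {W = 0} = {A, B}, A ≠ B, and A' − B' = 2 a ⊗ ν̄ for
some a ∈ ℝ³ and a unit vector ν̄ ∈ ℝ². -/
def H1 (W : M33 → ℝ) (A B : M33) : Prop :=
  (∀ ξ, 0 ≤ W ξ) ∧ (∀ ξ, W ξ = 0 ↔ ξ = A ∨ ξ = B) ∧ A ≠ B ∧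
    ∃ (a : V3) (ν : ℝ × ℝ), ν.1 ^ 2 + ν.2 ^ 2 = 1 ∧
      A 0 - B 0 = (2 * ν.1) • a ∧ A 1 - B 1 = (2 * ν.2) • a

/-- Hypothesis (H2): p-growth from above and below. -/
def H2 (W : M33 → ℝ) (p : ℝ) : Prop :=
  ∃ C > (0 : ℝ), ∀ ξ, C⁻¹ * (mnorm ξ) ^ p - C ≤ W ξ ∧ W ξ ≤ C * (mnorm ξ) ^ p + C

/-- Hypothesis (H3): non-degeneracy near the wells. -/
def H3 (W : M33 → ℝ) (A B : M33) (p : ℝ) : Prop :=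
  ∃ ϱ > (0 : ℝ), ∃ C > (0 : ℝ), ∀ ξ, mdist A B ξ ≤ ϱ →
    C⁻¹ * (mdist A B ξ) ^ p ≤ W ξ ∧ W ξ ≤ C * (mdist A B ξ) ^ p

/-- Hypothesis (H4): W(ξ₁, 0, ξ₃) ≤ W(ξ). -/
def H4 (W : M33 → ℝ) : Prop := ∀ ξ : M33, W ![ξ 0, 0, ξ 2] ≤ W ξ

/-- Normalization of the wells: A = −B, first column of A is a, second column is 0. -/
def Wells (A B : M33) (a : V3) : Prop := A = -B ∧ A 0 = a ∧ A 1 = 0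

/-- ū₀(t) = |t| a. -/
def ub0 (a : V3) (t : ℝ) : V3 := |t| • a

/-- b̄₀(t) = A₃ for t ≥ 0, −A₃ (= B₃) for t < 0. -/
def bb0 (A3 : V3) (t : ℝ) : V3 := if 0 ≤ t then A3 else -A3

/-- u₀(x) = ū₀(x₁). -/
def u0 (a : V3) (x : Pt) : V3 := ub0 a x.1

/-- b₀(x) = b̄₀(x₁). -/
def b0 (A3 : V3) (x : Pt) : V3 := bb0 A3 x.1

/-- The interval I = (−1/2, 1/2). -/
def II : Set ℝ := Set.Ioo (-(1 / 2 : ℝ)) (1 / 2)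

/-- The unit cube Q = I × I × I. -/
def Q3 : Set Pt := II ×ˢ (II ×ˢ II)

/-- J_ρ = (ρ I) × J × I. -/
def Jrho (J : Set ℝ) (ρ : ℝ) : Set Pt := (Set.Ioo (-(ρ / 2)) (ρ / 2)) ×ˢ (J ×ˢ II)

/-- The rescaled thin domain Ω = ω × I. -/
def Om (ω : Set (ℝ × ℝ)) : Set Pt := {x | (x.1, x.2.1) ∈ ω ∧ x.2.2 ∈ II}

/-- L¹ convergence on a set U. -/
def TendsL1 (U : Set Pt) (f : ℕ → Pt → V3) (g : Pt → V3) : Prop :=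
  Tendsto (fun n => ∫⁻ x in U, ENNReal.ofReal (vnorm (f n x - g x))) atTop (nhds 0)

/-- L^q convergence on a set U. -/
def TendsLp (U : Set Pt) (q : ℝ) (f : ℕ → Pt → V3) (g : Pt → V3) : Prop :=
  Tendsto (fun n => ∫⁻ x in U, ENNReal.ofReal ((vnorm (f n x - g x)) ^ q)) atTop (nhds 0)

/-- The localized asymptotic energy 𝓔_γ(J, ρ). -/
def Egam (W : M33 → ℝ) (a A3 : V3) (γ : ℝ) (J : Set ℝ) (ρ : ℝ) : ℝ≥0∞ :=
  sInf { L : ℝ≥0∞ | ∃ (h ε : ℕ → ℝ) (u : ℕ → Pt → V3),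
    (∀ n, 0 < h n) ∧ (∀ n, 0 < ε n) ∧
    Tendsto h atTop (nhds 0) ∧ Tendsto ε atTop (nhds 0) ∧
    Tendsto (fun n => h n / ε n) atTop (nhds γ) ∧
    (∀ n, ContDiffOn ℝ 2 (u n) (Jrho J ρ)) ∧
    TendsL1 (Jrho J ρ) u (u0 a) ∧
    TendsL1 (Jrho J ρ) (fun n x => (h n)⁻¹ • pd e3 (u n) x) (b0 A3) ∧
    L = Filter.liminf (fun n => F W (h n) (ε n) (u n) (Jrho J ρ)) atTop }

/-- K*_γ = 𝓔_γ(I, 1). -/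
def Kstar (W : M33 → ℝ) (a A3 : V3) (γ : ℝ) : ℝ≥0∞ := Egam W a A3 γ II 1

/-- K*_∞ : the analogue of K*_γ for h/ε → ∞, on the unit cube Q. -/
def KstarInf (W : M33 → ℝ) (a A3 : V3) : ℝ≥0∞ :=
  sInf { L : ℝ≥0∞ | ∃ (h ε : ℕ → ℝ) (u : ℕ → Pt → V3),
    (∀ n, 0 < h n) ∧ (∀ n, 0 < ε n) ∧
    Tendsto h atTop (nhds 0) ∧ Tendsto ε atTop (nhds 0) ∧
    Tendsto (fun n => h n / ε n) atTop atTop ∧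
    (∀ n, ContDiffOn ℝ 2 (u n) Q3) ∧
    TendsL1 Q3 u (u0 a) ∧
    TendsL1 Q3 (fun n x => (h n)⁻¹ • pd e3 (u n) x) (b0 A3) ∧
    L = Filter.liminf (fun n => F W (h n) (ε n) (u n) Q3) atTop }

open Classical in
/-- The phase matrix: B on E, A off E. -/
def Mfun (A B : M33) (E : Set (ℝ × ℝ)) (x' : ℝ × ℝ) : M33 := if x' ∈ E then B else A

/-! ### Two-dimensional objects -/

abbrev Pt2 := ℝ × ℝ

/-- Directional partial derivative of a map `v : ℝ² → ℝ³`. -/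
def qd (e : Pt2) (v : Pt2 → V3) (y : Pt2) : V3 := fderiv ℝ v y e

def f1 : Pt2 := (1, 0)
def f2 : Pt2 := (0, 1)

/-- 𝒲(∇v) = W(∂₁v, 0, ∂₂v). -/
def W2 (W : M33 → ℝ) (v : Pt2 → V3) (y : Pt2) : ℝ := W ![qd f1 v y, 0, qd f2 v y]

/-- Squared 2D Hessian |∇²v|². -/
def hess2d (v : Pt2 → V3) (y : Pt2) : ℝ :=
  (vnorm (qd f1 (qd f1 v) y)) ^ 2 + 2 * (vnorm (qd f2 (qd f1 v) y)) ^ 2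
    + (vnorm (qd f2 (qd f2 v) y)) ^ 2

/-- The rectangle ℓI × γI. -/
def Rect (ℓ γ : ℝ) : Set Pt2 := Set.Ioo (-(ℓ / 2)) (ℓ / 2) ×ˢ Set.Ioo (-(γ / 2)) (γ / 2)

/-- The optimal-profile constant K_γ of the critical regime. -/
def Kgam (W : M33 → ℝ) (a A3 : V3) (γ : ℝ) : ℝ≥0∞ :=
  sInf { L : ℝ≥0∞ | ∃ ℓ > (0 : ℝ), ∃ v : Pt2 → V3,
    ContDiffOn ℝ 2 v (Rect ℓ γ) ∧
    (∃ δ > (0 : ℝ), ∀ y ∈ Rect ℓ γ, ℓ / 2 - δ < y.1 → qd f1 v y = a ∧ qd f2 v y = A3) ∧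
    (∃ δ > (0 : ℝ), ∀ y ∈ Rect ℓ γ, y.1 < -(ℓ / 2) + δ → qd f1 v y = -a ∧ qd f2 v y = -A3) ∧
    L = ENNReal.ofReal γ⁻¹ *
      ∫⁻ y in Rect ℓ γ, ENNReal.ofReal (W2 W v y + hess2d v y) }

/-- The 2D subcritical functional F⁰_ε(u, b, D). -/
def F0 (W : M33 → ℝ) (ε : ℝ) (u b : Pt2 → V3) (D : Set Pt2) : ℝ≥0∞ :=
  ∫⁻ y in D, ENNReal.ofReal (ε⁻¹ * W ![qd f1 u y, qd f2 u y, b y]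
    + ε * ((vnorm (qd f1 (qd f1 u) y)) ^ 2 + 2 * (vnorm (qd f2 (qd f1 u) y)) ^ 2
      + (vnorm (qd f2 (qd f2 u) y)) ^ 2
      + 2 * (vnorm (qd f1 b y)) ^ 2 + 2 * (vnorm (qd f2 b y)) ^ 2))

/-- K*₀: the subcritical cell constant. -/
def Kstar0 (W : M33 → ℝ) (a A3 : V3) : ℝ≥0∞ :=
  sInf { L : ℝ≥0∞ | ∃ (ε : ℕ → ℝ) (u b : ℕ → Pt2 → V3),
    (∀ n, 0 < ε n) ∧ Tendsto ε atTop (nhds 0) ∧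
    (∀ n, ContDiffOn ℝ 2 (u n) (II ×ˢ II)) ∧ (∀ n, ContDiffOn ℝ 1 (b n) (II ×ˢ II)) ∧
    Tendsto (fun n => ∫⁻ y in II ×ˢ II,
      ENNReal.ofReal (vnorm (u n y - ub0 a y.1) + vnorm (b n y - bb0 A3 y.1)))
      atTop (nhds 0) ∧
    L = Filter.liminf (fun n => F0 W (ε n) (u n) (b n) (II ×ˢ II)) atTop }

/-- K₀: the subcritical optimal-profile constant. -/
def K0 (W : M33 → ℝ) (a A3 : V3) : ℝ≥0∞ :=
  sInf { L : ℝ≥0∞ | ∃ ℓ > (0 : ℝ), ∃ φ1 φ2 : ℝ → V3,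
    ContDiffOn ℝ 1 φ1 (Set.Icc (-ℓ) ℓ) ∧ ContDiffOn ℝ 1 φ2 (Set.Icc (-ℓ) ℓ) ∧
    φ1 ℓ = a ∧ φ2 ℓ = A3 ∧ φ1 (-ℓ) = -a ∧ φ2 (-ℓ) = -A3 ∧
    L = ∫⁻ t in Set.Ioo (-ℓ) ℓ, ENNReal.ofReal (W ![φ1 t, 0, φ2 t]
      + (vnorm (derivWithin φ1 (Set.Icc (-ℓ) ℓ) t)) ^ 2
      + 2 * (vnorm (derivWithin φ2 (Set.Icc (-ℓ) ℓ) t)) ^ 2) }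

/-- K_∞ in the case λ = 0. -/
def KinfZero (W : M33 → ℝ) (a : V3) : ℝ≥0∞ :=
  sInf { L : ℝ≥0∞ | ∃ ℓ > (0 : ℝ), ∃ v : Pt2 → V3,
    ContDiff ℝ 2 v ∧ (∀ y : Pt2, v (y.1, y.2 + 1) = v y) ∧
    (∃ δ > (0 : ℝ), ∀ y : Pt2, |y.1 - 1 / 2| < δ → qd f1 v y = a ∧ qd f2 v y = 0) ∧
    (∃ δ > (0 : ℝ), ∀ y : Pt2, |y.1 + 1 / 2| < δ → qd f1 v y = -a ∧ qd f2 v y = 0) ∧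
    L = ∫⁻ y in II ×ˢ II, ENNReal.ofReal (ℓ * W2 W v y + ℓ⁻¹ * hess2d v y) }

/-- The unit normal ν_λ = (1+λ²)^{-1/2} (1, λ). -/
def nuv (lam : ℝ) : Pt2 := (1 / Real.sqrt (1 + lam ^ 2), lam / Real.sqrt (1 + lam ^ 2))

/-- The orthogonal direction ν_λ^⊥ = (1+λ²)^{-1/2} (−λ, 1). -/
def nupv (lam : ℝ) : Pt2 := (-lam / Real.sqrt (1 + lam ^ 2), 1 / Real.sqrt (1 + lam ^ 2))

/-- Dot product on ℝ². -/
def dotp (w y : Pt2) : ℝ := w.1 * y.1 + w.2 * y.2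

/-- The unit square Q'_λ centered at 0 with two sides orthogonal to ν_λ. -/
def Qlam (lam : ℝ) : Set Pt2 := {y | |dotp (nuv lam) y| < 1 / 2 ∧ |dotp (nupv lam) y| < 1 / 2}

/-- K_∞ for general λ. -/
def KinfL (W : M33 → ℝ) (a : V3) (lam : ℝ) : ℝ≥0∞ :=
  ENNReal.ofReal (Real.sqrt (1 + lam ^ 2)) *
    sInf { L : ℝ≥0∞ | ∃ ℓ > (0 : ℝ), ∃ v : Pt2 → V3,
      ContDiff ℝ 2 v ∧ (∀ y : Pt2, v (y + nupv lam) = v y) ∧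
      (∃ δ > (0 : ℝ), ∀ y : Pt2, |dotp (nuv lam) y - 1 / 2| < δ →
        qd f1 v y = a ∧ qd f2 v y = lam • a) ∧
      (∃ δ > (0 : ℝ), ∀ y : Pt2, |dotp (nuv lam) y + 1 / 2| < δ →
        qd f1 v y = -a ∧ qd f2 v y = -(lam • a)) ∧
      L = ∫⁻ y in Qlam lam, ENNReal.ofReal (ℓ * W2 W v y + ℓ⁻¹ * hess2d v y) }

/-- Number of interfaces strictly below t. -/
def cnt (m : ℕ) (α : Fin m → ℝ) (t : ℝ) : ℕ := (Finset.univ.filter (fun i => α i < t)).card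

end

section Segments

variable {E : Type*} [NormedAddCommGroup E] [NormedSpace ℝ E] [FiniteDimensional ℝ E]
  [MeasurableSpace E] [BorelSpace E] (μ : Measure E) [μ.IsAddHaarMeasure]

lemma lintegral_comp_smul_add {G : E → ℝ≥0∞} (hG : Measurable G) {r : ℝ} (hr : r ≠ 0) (v : E) :
    ∫⁻ x, G (r • x + v) ∂μ
      = ENNReal.ofReal |(r ^ Module.finrank ℝ E)⁻¹| * ∫⁻ x, G x ∂μ := by
  have h1 : Measurable fun x => G (x + v) := hG.comp (measurable_id.add_const v)
  have h2 : ∫⁻ x, G (x + v) ∂(μ.map (r • ·)) = ∫⁻ x, G (r • x + v) ∂μ :=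
    lintegral_map h1 (measurable_const_smul r)
  rw [← h2, Measure.map_addHaar_smul μ hr, lintegral_smul_measure,
    lintegral_add_right_eq_self (μ := μ) G v, smul_eq_mul]

lemma setLIntegral_convexComb_le {S : Set E} (hS : MeasurableSet S) (hSc : Convex ℝ S)
    {G : E → ℝ≥0∞} (hG : Measurable G) {r : ℝ} (hr : 1 / 2 ≤ r) (hr1 : r ≤ 1) {y : E} (hy : y ∈ S) :
    ∫⁻ x in S, G (r • x + (1 - r) • y) ∂μ ≤ 2 ^ Module.finrank ℝ E * ∫⁻ x in S, G x ∂μ := by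
  calc ∫⁻ x in S, G (r • x + (1 - r) • y) ∂μ
      ≤ ∫⁻ x in S, S.indicator G (r • x + (1 - r) • y) ∂μ := by
        refine setLIntegral_mono' hS fun x hx => ?_
        rw [indicator_of_mem (hSc hx hy (by linarith) (by linarith) (by ring))]
    _ ≤ ∫⁻ x, S.indicator G (r • x + (1 - r) • y) ∂μ := setLIntegral_le_lintegral _ _
    _ = ENNReal.ofReal |(r ^ Module.finrank ℝ E)⁻¹| * ∫⁻ x, S.indicator G x ∂μ :=
        lintegral_comp_smul_add μ (hG.indicator hS) (by linarith) _
    _ ≤ _ := by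
        rw [lintegral_indicator hS]
        gcongr
        rw [abs_of_nonneg (by positivity), ← inv_pow]
        have : r⁻¹ ≤ 2 := by
          rw [inv_le_comm₀ (by linarith) (by norm_num)]; linarith
        calc ENNReal.ofReal (r⁻¹ ^ Module.finrank ℝ E)
            ≤ ENNReal.ofReal (2 ^ Module.finrank ℝ E) := by gcongr
          _ = _ := by rw [ENNReal.ofReal_pow (by norm_num)]; norm_num

/-- The average of a nonnegative function over all segments joining two points of a convex set is
controlled by its integral. -/
lemma lintegral_segments_le {S : Set E} (hS : MeasurableSet S) (hSc : Convex ℝ S)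
    {G : E → ℝ≥0∞} (hG : Measurable G) :
    ∫⁻ x in S, ∫⁻ y in S, (∫⁻ t in Icc (0 : ℝ) 1, G (x + t • (y - x))) ∂μ ∂μ
      ≤ 2 ^ Module.finrank ℝ E * μ S * ∫⁻ x in S, G x ∂μ := by
  set d := Module.finrank ℝ E
  have hmeas : Measurable fun q : (E × E) × ℝ => G (q.1.1 + q.2 • (q.1.2 - q.1.1)) :=
    hG.comp (by fun_prop)
  have swap1 : ∀ x, ∫⁻ y in S, (∫⁻ t in Icc (0 : ℝ) 1, G (x + t • (y - x))) ∂μ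
      = ∫⁻ t in Icc (0 : ℝ) 1, ∫⁻ y in S, G (x + t • (y - x)) ∂μ := fun x =>
    lintegral_lintegral_swap (hG.comp (by fun_prop :
      Measurable fun q : E × ℝ => x + q.2 • (q.1 - x))).aemeasurable
  have hm2 : Measurable fun q : E × ℝ => ∫⁻ y in S, G (q.1 + q.2 • (y - q.1)) ∂μ :=
    Measurable.lintegral_prod_right' (f := fun r : (E × ℝ) × E => G (r.1.1 + r.1.2 • (r.2 - r.1.1)))
      (hG.comp (by fun_prop))
  calc ∫⁻ x in S, ∫⁻ y in S, (∫⁻ t in Icc (0 : ℝ) 1, G (x + t • (y - x))) ∂μ ∂μ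
      = ∫⁻ t in Icc (0 : ℝ) 1, (∫⁻ x in S, ∫⁻ y in S, G (x + t • (y - x)) ∂μ ∂μ) := by
        simp_rw [swap1]
        exact lintegral_lintegral_swap hm2.aemeasurable
    _ ≤ ∫⁻ t in Icc (0 : ℝ) 1, 2 ^ d * μ S * ∫⁻ x in S, G x ∂μ := by
        refine setLIntegral_mono' measurableSet_Icc fun t ht => ?_
        rcases le_total (1 / 2) t with h | h
        · calc ∫⁻ x in S, ∫⁻ y in S, G (x + t • (y - x)) ∂μ ∂μ
              ≤ ∫⁻ x in S, 2 ^ d * ∫⁻ x in S, G x ∂μ ∂μ := by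
                refine setLIntegral_mono' hS fun x hx => ?_
                refine le_trans (le_of_eq ?_) (setLIntegral_convexComb_le μ hS hSc hG h ht.2 hx)
                congr! 3 with y
                module
            _ = _ := by rw [setLIntegral_const]; ring
        · rw [lintegral_lintegral_swap (f := fun x y => G (x + t • (y - x))) (hG.comp (by fun_prop :
            Measurable fun q : E × E => q.1 + t • (q.2 - q.1))).aemeasurable]
          calc ∫⁻ y in S, ∫⁻ x in S, G (x + t • (y - x)) ∂μ ∂μ
              ≤ ∫⁻ x in S, 2 ^ d * ∫⁻ x in S, G x ∂μ ∂μ := by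
                refine setLIntegral_mono' hS fun y hy => ?_
                refine le_trans (le_of_eq ?_) (setLIntegral_convexComb_le μ hS hSc hG
                  (r := 1 - t) (by linarith) (by linarith [ht.1]) hy)
                congr! 3 with x
                module
            _ = _ := by rw [setLIntegral_const]; ring
    _ = _ := by simp

end Segments

lemma enorm_sub_le_lintegral_fderiv_segment {E V : Type*} [NormedAddCommGroup E]
    [NormedSpace ℝ E] [NormedAddCommGroup V] [NormedSpace ℝ V]
    {U : Set E} (hU : IsOpen U) {f : E → V} (hf : ContDiffOn ℝ 1 f U) {x y : E}
    (hxy : segment ℝ x y ⊆ U) :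
    ‖f y - f x‖ₑ ≤ ∫⁻ t in Icc (0 : ℝ) 1, ‖fderiv ℝ f (x + t • (y - x)) (y - x)‖ₑ := by
  have hseg : ∀ t ∈ Icc (0 : ℝ) 1, x + t • (y - x) ∈ U := fun t ht =>
    hxy (by rw [segment_eq_image']; exact ⟨t, ht, rfl⟩)
  have hg : ContDiffOn ℝ 1 (fun t : ℝ => f (x + t • (y - x))) (Icc 0 1) :=
    hf.comp (by fun_prop : ContDiff ℝ 1 fun t : ℝ => x + t • (y - x)).contDiffOn hseg
  have := enorm_sub_le_lintegral_deriv_of_contDiffOn_Icc hg zero_le_one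
  simp only [one_smul, zero_smul, add_zero, add_sub_cancel] at this
  refine this.trans (setLIntegral_mono' measurableSet_Icc fun t ht => le_of_eq ?_)
  have hd : HasFDerivAt f (fderiv ℝ f (x + t • (y - x))) (x + t • (y - x)) :=
    ((hf.differentiableOn (by norm_num)).differentiableAt
      (hU.mem_nhds (hseg t ht))).hasFDerivAt
  have h2 : HasDerivAt (fun t : ℝ => x + t • (y - x)) (y - x) t := by
    simpa using ((hasDerivAt_id t).smul_const (y - x)).const_add x
  rw [show deriv (fun t : ℝ => f (x + t • (y - x))) t = _ from (hd.comp_hasDerivAt t h2).deriv]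

section Poincare

lemma rpow_lintegral_le_lintegral_rpow {α : Type*} [MeasurableSpace α] {μ : Measure α}
    [IsProbabilityMeasure μ] {f : α → ℝ≥0∞} (hf : AEMeasurable f μ) {p : ℝ} (hp : 1 ≤ p) :
    (∫⁻ x, f x ∂μ) ^ p ≤ ∫⁻ x, f x ^ p ∂μ := by
  have h := eLpNorm'_le_eLpNorm'_of_exponent_le zero_lt_one hp μ hf.aestronglyMeasurable
  simp only [eLpNorm', enorm_eq_self, ENNReal.rpow_one, div_one] at h
  calc (∫⁻ x, f x ∂μ) ^ p ≤ ((∫⁻ x, f x ^ p ∂μ) ^ (1 / p)) ^ p := by gcongr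
    _ = _ := by rw [← ENNReal.rpow_mul, one_div_mul_cancel (by linarith), ENNReal.rpow_one]

variable {E V : Type*} [NormedAddCommGroup E] [NormedSpace ℝ E] [FiniteDimensional ℝ E]
  [MeasurableSpace E] [BorelSpace E] (μ : Measure E) [μ.IsAddHaarMeasure]
  [NormedAddCommGroup V] [NormedSpace ℝ V]

lemma lintegral_lintegral_enorm_sub_rpow_le {p : ℝ} (hp : 1 ≤ p) {U S : Set E} (hU : IsOpen U)
    (hSU : S ⊆ U) (hS : MeasurableSet S) (hSc : Convex ℝ S) {f : E → V}
    (hf : ContDiffOn ℝ 1 f U) {G : E → ℝ≥0∞} (hG : Measurable G)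
    (hfG : ∀ x ∈ S, ∀ y ∈ S, ∀ z ∈ S, ‖fderiv ℝ f z (y - x)‖ₑ ≤ G z) :
    ∫⁻ x in S, ∫⁻ y in S, ‖f y - f x‖ₑ ^ p ∂μ ∂μ
      ≤ 2 ^ Module.finrank ℝ E * μ S * ∫⁻ x in S, G x ^ p ∂μ := by
  refine le_trans (setLIntegral_mono' hS fun x hx => setLIntegral_mono' hS fun y hy => ?_)
    (lintegral_segments_le μ hS hSc (hG.pow_const p))
  have hprob : IsProbabilityMeasure (volume.restrict (Icc (0 : ℝ) 1)) := ⟨by simp⟩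
  calc ‖f y - f x‖ₑ ^ p
      ≤ (∫⁻ t in Icc (0 : ℝ) 1, G (x + t • (y - x))) ^ p := by
        gcongr
        refine (enorm_sub_le_lintegral_fderiv_segment hU hf
          ((hSc.segment_subset hx hy).trans hSU)).trans
          (setLIntegral_mono' measurableSet_Icc fun t ht => hfG x hx y hy _ ?_)
        exact hSc.add_smul_sub_mem hx hy ht
    _ ≤ _ := rpow_lintegral_le_lintegral_rpow
        (hG.comp (by fun_prop : Measurable fun t : ℝ => x + t • (y - x))).aemeasurable hp

/-- Poincaré inequality on a convex set. -/
lemma lintegral_enorm_sub_average_rpow_le [CompleteSpace V] {p : ℝ} (hp : 1 ≤ p) {U S : Set E}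
    (hU : IsOpen U) (hSU : S ⊆ U) (hS : MeasurableSet S) (hSc : Convex ℝ S) (hSfin : μ S ≠ ∞)
    {f : E → V} (hf : ContDiffOn ℝ 1 f U) {G : E → ℝ≥0∞} (hG : Measurable G)
    (hfG : ∀ x ∈ S, ∀ y ∈ S, ∀ z ∈ S, ‖fderiv ℝ f z (y - x)‖ₑ ≤ G z)
    (hint : IntegrableOn f S μ) :
    ∫⁻ x in S, ‖f x - ⨍ y in S, f y ∂μ‖ₑ ^ p ∂μ
      ≤ 2 ^ Module.finrank ℝ E * ∫⁻ x in S, G x ^ p ∂μ := by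
  rcases eq_or_ne (μ S) 0 with h0 | h0
  · simp [Measure.restrict_eq_zero.2 h0]
  set ν := μ.restrict S with hν
  have hνu : ν univ = μ S := by simp [ν]
  have : NeZero ν := ⟨by rwa [hν, Ne, Measure.restrict_eq_zero]⟩
  have : IsFiniteMeasure ν := ⟨by rw [hνu]; exact hSfin.lt_top⟩
  have key : ∀ x, ‖f x - ⨍ y, f y ∂ν‖ₑ ^ p ≤ (μ S)⁻¹ * ∫⁻ y, ‖f y - f x‖ₑ ^ p ∂ν := by
    intro x
    have hintP : Integrable f ((ν univ)⁻¹ • ν) := hint.to_average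
    have h1 : f x - ⨍ y, f y ∂ν = ∫ y, (f x - f y) ∂((ν univ)⁻¹ • ν) := by
      rw [integral_sub (integrable_const _) hintP]; simp [average]
    calc ‖f x - ⨍ y, f y ∂ν‖ₑ ^ p
        ≤ (∫⁻ y, ‖f y - f x‖ₑ ∂((ν univ)⁻¹ • ν)) ^ p := by
          gcongr
          rw [h1]
          refine (enorm_integral_le_lintegral_enorm _).trans (le_of_eq ?_)
          simp_rw [← edist_eq_enorm_sub, edist_comm]
      _ ≤ ∫⁻ y, ‖f y - f x‖ₑ ^ p ∂((ν univ)⁻¹ • ν) :=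
          rpow_lintegral_le_lintegral_rpow
            (hintP.aestronglyMeasurable.sub aestronglyMeasurable_const).enorm hp
      _ = _ := by rw [lintegral_smul_measure, hνu, smul_eq_mul]
  calc ∫⁻ x, ‖f x - ⨍ y, f y ∂ν‖ₑ ^ p ∂ν
      ≤ ∫⁻ x, (μ S)⁻¹ * ∫⁻ y, ‖f y - f x‖ₑ ^ p ∂ν ∂ν := lintegral_mono key
    _ = (μ S)⁻¹ * ∫⁻ x, ∫⁻ y, ‖f y - f x‖ₑ ^ p ∂ν ∂ν :=
        lintegral_const_mul' _ _ (ENNReal.inv_ne_top.2 h0)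
    _ ≤ (μ S)⁻¹ * (2 ^ Module.finrank ℝ E * μ S * ∫⁻ x in S, G x ^ p ∂μ) := by
        gcongr
        exact lintegral_lintegral_enorm_sub_rpow_le μ hp hU hSU hS hSc hf hG hfG
    _ = 2 ^ Module.finrank ℝ E * ∫⁻ x in S, G x ^ p ∂μ := by
        rw [mul_comm (2 ^ _) (μ S), mul_assoc, ← mul_assoc,
          ENNReal.inv_mul_cancel h0 hSfin, one_mul]

lemma memLp_of_fderiv_bound [SecondCountableTopology V] {p : ℝ} (hp : 1 ≤ p) {U S : Set E}
    (hU : IsOpen U) (hSU : S ⊆ U) (hS : MeasurableSet S) (hSc : Convex ℝ S) (hSfin : μ S ≠ ∞)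
    {f : E → V} (hf : ContDiffOn ℝ 1 f U) {G : E → ℝ≥0∞} (hG : Measurable G)
    (hfG : ∀ x ∈ S, ∀ y ∈ S, ∀ z ∈ S, ‖fderiv ℝ f z (y - x)‖ₑ ≤ G z)
    (hGfin : ∫⁻ x in S, G x ^ p ∂μ ≠ ∞) :
    MemLp f (ENNReal.ofReal p) (μ.restrict S) := by
  rcases eq_or_ne (μ S) 0 with h0 | h0
  · simp [Measure.restrict_eq_zero.2 h0]
  have : IsFiniteMeasure (μ.restrict S) := ⟨by simpa using hSfin.lt_top⟩
  have hne : NeZero (μ.restrict S) := ⟨by rwa [Ne, Measure.restrict_eq_zero]⟩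
  have hfm : AEStronglyMeasurable f (μ.restrict S) :=
    (hf.continuousOn.mono hSU).aestronglyMeasurable hS
  have hlt : ∫⁻ x in S, ∫⁻ y in S, ‖f y - f x‖ₑ ^ p ∂μ ∂μ ≠ ∞ :=
    ne_top_of_le_ne_top (by finiteness)
      (lintegral_lintegral_enorm_sub_rpow_le μ hp hU hSU hS hSc hf hG hfG)
  obtain ⟨x, hx⟩ : ∃ x, ∫⁻ y in S, ‖f y - f x‖ₑ ^ p ∂μ < ∞ := by
    by_contra! hcon
    have : ∀ x, ∫⁻ y in S, ‖f y - f x‖ₑ ^ p ∂μ = ∞ := fun x => top_le_iff.1 (hcon x)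
    apply hlt
    simp_rw [this]
    simp [ENNReal.top_mul, h0]
  have h1 : MemLp (fun y => f y - f x) (ENNReal.ofReal p) (μ.restrict S) := by
    refine ⟨hfm.sub aestronglyMeasurable_const, ?_⟩
    rw [eLpNorm_lt_top_iff_lintegral_rpow_enorm_lt_top (by simp; linarith) (by simp),
      ENNReal.toReal_ofReal (by linarith)]
    exact hx
  convert h1.add (memLp_const (f x)) using 1
  ext y
  simp

end Poincare

section Complete

lemma exists_tendsto_eLpNorm_of_cauchy {α V : Type*} [MeasurableSpace α] {μ : Measure α}
    [NormedAddCommGroup V] [CompleteSpace V] {p : ℝ≥0∞} (hp : 1 ≤ p) {f : ℕ → α → V}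
    (hf : ∀ n, MemLp (f n) p μ)
    (hc : ∀ η : ℝ≥0∞, 0 < η → ∃ N, ∀ n ≥ N, ∀ m ≥ N, eLpNorm (f n - f m) p μ < η) :
    ∃ g : α → V, MemLp g p μ ∧ Tendsto (fun n => eLpNorm (f n - g) p μ) atTop (𝓝 0) := by
  have : Fact (1 ≤ p) := ⟨hp⟩
  have hcau : CauchySeq fun n => (hf n).toLp (f n) := by
    refine EMetric.cauchySeq_iff.2 fun η hη => ?_
    obtain ⟨N, hN⟩ := hc η hη
    refine ⟨N, fun n hn m hm => ?_⟩
    rw [Lp.edist_toLp_toLp]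
    exact hN n hn m hm
  obtain ⟨g, hg⟩ := cauchySeq_tendsto_of_complete hcau
  refine ⟨g, Lp.memLp g, ?_⟩
  rw [← Lp.toLp_coeFn g (Lp.memLp g)] at hg
  have := tendsto_iff_edist_tendsto_0.1 hg
  simpa only [Lp.edist_toLp_toLp] using this

end Complete

section Domain

instance isAddHaarMeasure_volume_plane : (volume : Measure (ℝ × ℝ)).IsAddHaarMeasure :=
  inferInstanceAs ((volume : Measure ℝ).prod (volume : Measure ℝ)).IsAddHaarMeasure

instance isAddHaarMeasure_volume_space : (volume : Measure Pt).IsAddHaarMeasure :=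
  inferInstanceAs ((volume : Measure ℝ).prod (volume : Measure (ℝ × ℝ))).IsAddHaarMeasure

lemma measurable_planar : Measurable fun x : Pt => (x.1, x.2.1) := by fun_prop

lemma isOpen_Om {ω : Set (ℝ × ℝ)} (hω : IsOpen ω) : IsOpen (Om ω) :=
  (hω.preimage (by fun_prop : Continuous fun x : Pt => (x.1, x.2.1))).inter
    (isOpen_Ioo.preimage (by fun_prop : Continuous fun x : Pt => x.2.2))

lemma convex_Om {ω : Set (ℝ × ℝ)} (hω : Convex ℝ ω) : Convex ℝ (Om ω) := by
  intro x hx y hy a b ha hb hab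
  exact ⟨hω hx.1 hy.1 ha hb hab, convex_Ioo _ _ hx.2 hy.2 ha hb hab⟩

lemma exists_norm_le_of_mem_Om {ω : Set (ℝ × ℝ)} (hω : Bornology.IsBounded ω) :
    ∃ R, 0 < R ∧ ∀ x ∈ Om ω, ‖x‖ ≤ R := by
  obtain ⟨R, hR, h⟩ := hω.exists_pos_norm_le
  refine ⟨max R 1, by positivity, fun x hx => ?_⟩
  have h1 := h _ hx.1
  have h2 := hx.2
  simp only [II, mem_Ioo] at h2
  simp only [Prod.norm_def, Real.norm_eq_abs, max_le_iff] at h1 ⊢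
  refine ⟨h1.1.trans (le_max_left _ _), h1.2.trans (le_max_left _ _), ?_⟩
  exact (abs_le.2 ⟨by linarith, by linarith⟩).trans (le_max_right _ _)

lemma volume_Om_ne_top {ω : Set (ℝ × ℝ)} (hω : Bornology.IsBounded ω) : volume (Om ω) ≠ ∞ := by
  obtain ⟨R, -, h⟩ := exists_norm_le_of_mem_Om hω
  refine (Bornology.IsBounded.measure_lt_top ?_).ne
  exact isBounded_iff_forall_norm_le.2 ⟨R, h⟩

end Domain

section Columns

/-- The index of the dyadic square of side `2⁻ᵏ` containing a point of the plane. -/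
noncomputable def dyadicIndex (k : ℕ) (y : ℝ × ℝ) : ℤ × ℤ := (⌊2 ^ k * y.1⌋, ⌊2 ^ k * y.2⌋)

lemma measurable_dyadicIndex (k : ℕ) : Measurable (dyadicIndex k) := by
  unfold dyadicIndex
  fun_prop

/-- The part of the domain lying above a dyadic square. -/
def dyadicColumn (ω : Set (ℝ × ℝ)) (k : ℕ) (c : ℤ × ℤ) : Set Pt :=
  {x | x ∈ Om ω ∧ dyadicIndex k (x.1, x.2.1) = c}

lemma convex_dyadicColumn {ω : Set (ℝ × ℝ)} (hω : Convex ℝ ω) (k : ℕ) (c : ℤ × ℤ) :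
    Convex ℝ (dyadicColumn ω k c) := by
  have key : ∀ (m : ℤ) (s t a b : ℝ), 0 ≤ a → 0 ≤ b → a + b = 1 → ⌊2 ^ k * s⌋ = m →
      ⌊2 ^ k * t⌋ = m → ⌊2 ^ k * (a * s + b * t)⌋ = m := by
    intro m s t a b ha hb hab hs ht
    rw [Int.floor_eq_iff] at hs ht ⊢
    have := convex_Ico (m : ℝ) (m + 1) (x := 2 ^ k * s) hs (y := 2 ^ k * t) ht ha hb hab
    simp only [smul_eq_mul, mem_Ico] at this
    constructor <;> nlinarith [this.1, this.2]
  rintro x ⟨hx, rfl⟩ y ⟨hy, hxy⟩ a b ha hb hab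
  refine ⟨convex_Om hω hx hy ha hb hab, ?_⟩
  simp only [dyadicIndex, Prod.mk.injEq] at hxy ⊢
  exact ⟨key _ _ _ _ _ ha hb hab rfl hxy.1, key _ _ _ _ _ ha hb hab rfl hxy.2⟩

lemma abs_sub_le_of_floor_eq {k : ℕ} {s t : ℝ} (h : ⌊2 ^ k * s⌋ = ⌊2 ^ k * t⌋) :
    |s - t| ≤ (1 / 2) ^ k := by
  have h1 := Int.abs_sub_lt_one_of_floor_eq_floor h
  rw [← mul_sub, abs_mul, abs_of_pos (by positivity)] at h1
  rw [one_div, inv_pow, ← one_div, le_div_iff₀ (by positivity)]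
  linarith

lemma norm_average_le_one {α : Type*} [MeasurableSpace α] (μ : Measure α) {g : α → ℝ}
    (hg : ∀ x, |g x| ≤ 1) : |⨍ x, g x ∂μ| ≤ 1 := by
  have h := norm_integral_le_of_norm_le_const (μ := (μ univ)⁻¹ • μ) (f := g) (C := 1)
    (Eventually.of_forall hg)
  refine h.trans ?_
  rw [one_mul]
  refine ENNReal.toReal_le_of_le_ofReal zero_le_one ?_
  simp [ENNReal.inv_mul_le_one (μ univ)]

variable {ω : Set (ℝ × ℝ)}

lemma measurableSet_dyadicColumn (hω : IsOpen ω) (k : ℕ) (c : ℤ × ℤ) :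
    MeasurableSet (dyadicColumn ω k c) :=
  (isOpen_Om hω).measurableSet.inter
    (((measurable_dyadicIndex k).comp measurable_planar) (measurableSet_singleton c))

lemma setLIntegral_Om_eq_tsum (hω : IsOpen ω) (k : ℕ) (f : Pt → ℝ≥0∞) :
    ∫⁻ x in Om ω, f x = ∑' c, ∫⁻ x in dyadicColumn ω k c, f x := by
  have h1 : Om ω = ⋃ c, dyadicColumn ω k c := by
    ext x; simp [dyadicColumn]
  conv_lhs => rw [h1]
  refine lintegral_iUnion (measurableSet_dyadicColumn hω k) (fun c d hcd => ?_) f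
  refine disjoint_left.2 fun x hx hx' => hcd (hx.2.symm.trans hx'.2)

lemma lintegral_sub_columnAverage_le (hωo : IsOpen ω) (hωc : Convex ℝ ω)
    (hωb : Bornology.IsBounded ω) {h : ℝ} (hh : 0 < h) {g : Pt → ℝ}
    (hg : ContDiffOn ℝ 1 g (Om ω)) (hg1 : ∀ x, |g x| ≤ 1) {G : Pt → ℝ≥0∞} (hG : Measurable G)
    (hgG : ∀ z ∈ Om ω, ∀ w : Pt,
      ‖fderiv ℝ g z w‖ₑ ≤ ENNReal.ofReal (|w.1| + |w.2.1| + h * |w.2.2|) * G z) (k : ℕ) :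
    ∫⁻ x in Om ω, ‖g x - ⨍ y in dyadicColumn ω k (dyadicIndex k (x.1, x.2.1)), g y‖ₑ
      ≤ 2 ^ Module.finrank ℝ Pt * (ENNReal.ofReal (2 * (1 / 2) ^ k + h) * ∫⁻ x in Om ω, G x) := by
  rw [setLIntegral_Om_eq_tsum hωo k, setLIntegral_Om_eq_tsum hωo k, ← ENNReal.tsum_mul_left,
    ← ENNReal.tsum_mul_left]
  refine ENNReal.tsum_le_tsum fun c => ?_
  set S := dyadicColumn ω k c with hSdef
  have hSm : MeasurableSet S := measurableSet_dyadicColumn hωo k c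
  have hSO : S ⊆ Om ω := fun x hx => hx.1
  have hSfin : volume S ≠ ∞ := measure_ne_top_of_subset hSO (volume_Om_ne_top hωb)
  have hint : IntegrableOn g S := by
    have : IsFiniteMeasure (volume.restrict S) := ⟨by simpa using hSfin.lt_top⟩
    exact Integrable.of_bound ((hg.continuousOn.mono hSO).aestronglyMeasurable hSm) 1
      (Eventually.of_forall hg1)
  have := lintegral_enorm_sub_average_rpow_le volume le_rfl (isOpen_Om hωo) hSO hSm
    (convex_dyadicColumn hωc k c) hSfin hg (hG.const_mul (ENNReal.ofReal (2 * (1 / 2) ^ k + h)))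
    (fun x hx y hy z hz => ?_) hint
  · simp only [ENNReal.rpow_one] at this
    rw [lintegral_const_mul _ hG] at this
    refine le_trans (le_of_eq (setLIntegral_congr_fun hSm fun x hx => ?_)) this
    simp only [hx.2, ← hSdef]
  · refine (hgG z (hSO hz) _).trans ?_
    refine mul_le_mul' (ENNReal.ofReal_le_ofReal ?_) le_rfl
    have hxy := hx.2.trans hy.2.symm
    simp only [dyadicIndex, Prod.mk.injEq] at hxy
    have h1 := abs_sub_le_of_floor_eq hxy.1
    have h2 := abs_sub_le_of_floor_eq hxy.2
    rw [abs_sub_comm] at h1 h2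
    have hx3 := (hSO hx).2
    have hy3 := (hSO hy).2
    simp only [II, mem_Ioo] at hx3 hy3
    have h3 : |y.2.2 - x.2.2| ≤ 1 := abs_le.2 ⟨by linarith, by linarith⟩
    simp only [Prod.fst_sub, Prod.snd_sub]
    nlinarith

end Columns

section PhaseCompactness

variable {ω : Set (ℝ × ℝ)}

/-- A sequence of bounded functions on the thin domain whose rescaled gradients are bounded in `L¹`
converges almost everywhere, along a subsequence, to a function of the planar variables. -/
lemma exists_subseq_tendsto_planar (hωo : IsOpen ω) (hωc : Convex ℝ ω)
    (hωb : Bornology.IsBounded ω) {h : ℕ → ℝ} (hh : ∀ n, 0 < h n) (hh0 : Tendsto h atTop (𝓝 0))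
    {g : ℕ → Pt → ℝ} (hg : ∀ n, ContDiffOn ℝ 1 (g n) (Om ω)) (hgm : ∀ n, Measurable (g n))
    (hg1 : ∀ n x, |g n x| ≤ 1)
    {G : ℕ → Pt → ℝ≥0∞} (hG : ∀ n, Measurable (G n))
    (hgG : ∀ n, ∀ z ∈ Om ω, ∀ w : Pt,
      ‖fderiv ℝ (g n) z w‖ₑ ≤ ENNReal.ofReal (|w.1| + |w.2.1| + h n * |w.2.2|) * G n z)
    {K : ℝ≥0∞} (hK : K ≠ ∞) (hGK : ∀ n, ∫⁻ x in Om ω, G n x ≤ K) :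
    ∃ φ : ℕ → ℕ, StrictMono φ ∧ ∃ q : ℝ × ℝ → ℝ, Measurable q ∧
      ∀ᵐ x ∂(volume.restrict (Om ω)), Tendsto (fun n => g (φ n) x) atTop (𝓝 (q (x.1, x.2.1))) := by
  set μ := volume.restrict (Om ω) with hμ
  have hμfin : IsFiniteMeasure μ := ⟨by simpa [μ] using (volume_Om_ne_top hωb).lt_top⟩
  set π : Pt → ℝ × ℝ := fun x => (x.1, x.2.1) with hπ
  have hπm : Measurable π := measurable_planar
  set D : ℝ≥0∞ := 2 ^ Module.finrank ℝ Pt with hD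
  have hDfin : D ≠ ∞ := by simp [D]
  let avg : ℕ → ℕ × (ℤ × ℤ) → ℝ := fun n c => ⨍ y in dyadicColumn ω c.1 c.2, g n y
  obtain ⟨b, hb, φ, hφ, hφb⟩ := (isCompact_univ_pi fun _ : ℕ × (ℤ × ℤ) =>
    isCompact_Icc (a := (-1 : ℝ)) (b := 1)).tendsto_subseq (x := avg)
    (fun n c _ => abs_le.1 (norm_average_le_one _ (hg1 n)))
  have hφb' : ∀ c, Tendsto (fun n => avg (φ n) c) atTop (𝓝 (b c)) := fun c =>
    (tendsto_pi_nhds.1 hφb) c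
  have hb1 : ∀ c, |b c| ≤ 1 := fun c => abs_le.2 (hb c (mem_univ _))
  let q : ℕ → ℝ × ℝ → ℝ := fun k y => b (k, dyadicIndex k y)
  have hqm : ∀ k, Measurable (q k) := fun k =>
    (Measurable.of_discrete (f := fun c => b (k, c))).comp (measurable_dyadicIndex k)
  let r : ℕ → ℕ → ℝ≥0∞ := fun k n =>
    ∫⁻ x, ‖avg (φ n) (k, dyadicIndex k (π x)) - q k (π x)‖ₑ ∂μ
  have havgm : ∀ n k, Measurable fun x => avg (φ n) (k, dyadicIndex k (π x)) := fun n k =>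
    (Measurable.of_discrete (f := fun c => avg (φ n) (k, c))).comp
      ((measurable_dyadicIndex k).comp hπm)
  have hr : ∀ k, Tendsto (r k) atTop (𝓝 0) := by
    intro k
    have := tendsto_lintegral_of_dominated_convergence (μ := μ) (f := fun _ => 0)
      (F := fun n x => ‖avg (φ n) (k, dyadicIndex k (π x)) - q k (π x)‖ₑ)
      (fun _ => ENNReal.ofReal 2)
      (fun n => ((havgm n k).sub ((hqm k).comp hπm)).enorm)
      (fun n => Eventually.of_forall fun x => ?_) (by simp; finiteness)
      (Eventually.of_forall fun x => ?_)
    · simpa using this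
    · change ‖avg (φ n) (k, dyadicIndex k (π x)) - q k (π x)‖ₑ ≤ ENNReal.ofReal 2
      rw [← ofReal_norm]
      refine ENNReal.ofReal_le_ofReal ((norm_sub_le _ _).trans ?_)
      have h1 : ‖avg (φ n) (k, dyadicIndex k (π x))‖ ≤ 1 := norm_average_le_one _ (hg1 _)
      have h2 : ‖q k (π x)‖ ≤ 1 := hb1 _
      linarith
    · have := ((hφb' (k, dyadicIndex k (π x))).sub_const (q k (π x))).enorm
      simpa [q] using this
  have hgqm : ∀ k n, Measurable fun x => ‖g (φ n) x - q k (π x)‖ₑ := fun k n =>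
    ((hgm _).sub ((hqm k).comp hπm)).enorm
  let s : ℕ → ℕ → ℝ≥0∞ := fun k n => D * (ENNReal.ofReal (2 * (1 / 2) ^ k + h (φ n)) * K) + r k n
  have hs : ∀ k n, ∫⁻ x, ‖g (φ n) x - q k (π x)‖ₑ ∂μ ≤ s k n := by
    intro k n
    calc ∫⁻ x, ‖g (φ n) x - q k (π x)‖ₑ ∂μ
        ≤ ∫⁻ x, (‖g (φ n) x - avg (φ n) (k, dyadicIndex k (π x))‖ₑ
            + ‖avg (φ n) (k, dyadicIndex k (π x)) - q k (π x)‖ₑ) ∂μ := by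
          refine lintegral_mono fun x => ?_
          simp only [← edist_eq_enorm_sub]
          exact edist_triangle _ _ _
      _ = ∫⁻ x, ‖g (φ n) x - avg (φ n) (k, dyadicIndex k (π x))‖ₑ ∂μ + r k n :=
          lintegral_add_left ((hgm _).sub (havgm n k)).enorm _
      _ ≤ s k n := by
          refine add_le_add ((lintegral_sub_columnAverage_le hωo hωc hωb (hh _) (hg _) (hg1 _)
            (hG _) (hgG _) k).trans ?_) le_rfl
          gcongr
          exact hGK _
  let a : ℕ → ℝ≥0∞ := fun k => D * (ENNReal.ofReal (2 * (1 / 2) ^ k) * K)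
  have hsa : ∀ k, Tendsto (s k) atTop (𝓝 (a k)) := by
    intro k
    have h1 : Tendsto (fun n => 2 * (1 / 2 : ℝ) ^ k + h (φ n)) atTop (𝓝 (2 * (1 / 2) ^ k)) := by
      simpa using (hh0.comp hφ.tendsto_atTop).const_add (2 * (1 / 2 : ℝ) ^ k)
    have h2 := ENNReal.Tendsto.const_mul (ENNReal.Tendsto.mul_const
      (ENNReal.tendsto_ofReal h1) (Or.inr hK)) (Or.inr hDfin)
    simpa only [add_zero] using h2.add (hr k)
  have ha : Tendsto a atTop (𝓝 0) := by
    have h1 : Tendsto (fun k : ℕ => 2 * (1 / 2 : ℝ) ^ k) atTop (𝓝 (2 * 0)) :=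
      (_root_.tendsto_pow_atTop_nhds_zero_of_lt_one (by norm_num) (by norm_num)).const_mul 2
    have h2 := ENNReal.Tendsto.const_mul (ENNReal.Tendsto.mul_const
      (ENNReal.tendsto_ofReal h1) (Or.inr hK)) (Or.inr hDfin)
    simpa only [mul_zero, ENNReal.ofReal_zero, zero_mul] using h2
  have hqq : ∀ k l, ∫⁻ x, ‖q k (π x) - q l (π x)‖ₑ ∂μ ≤ a k + a l := by
    intro k l
    refine ge_of_tendsto ((hsa k).add (hsa l)) (Eventually.of_forall fun n => ?_)
    refine le_trans ?_ (add_le_add (hs k n) (hs l n))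
    rw [← lintegral_add_left (hgqm k n)]
    refine lintegral_mono fun x => ?_
    simp only [← edist_eq_enorm_sub]
    rw [edist_comm (g (φ n) x) (q k (π x))]
    exact edist_triangle _ _ _
  set ν := μ.map π with hν
  have : IsFiniteMeasure ν := Measure.isFiniteMeasure_map μ π
  have hmap : ∀ f : ℝ × ℝ → ℝ, AEStronglyMeasurable f ν →
      eLpNorm f 1 ν = ∫⁻ x, ‖f (π x)‖ₑ ∂μ := by
    intro f hf
    rw [hν, eLpNorm_map_measure hf hπm.aemeasurable, eLpNorm_one_eq_lintegral_enorm]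
    rfl
  obtain ⟨Q, hQ, hqQ⟩ := exists_tendsto_eLpNorm_of_cauchy (μ := ν) (p := 1) le_rfl (f := q)
    (fun k => MemLp.of_bound (hqm k).aestronglyMeasurable 1
      (Eventually.of_forall fun y => hb1 _)) (by
    intro η hη
    have h2 : Tendsto (fun k => a k + a k) atTop (𝓝 0) := by simpa using ha.add ha
    have hη2 : 0 < η / 2 := ENNReal.half_pos hη.ne'
    obtain ⟨N, hN⟩ := eventually_atTop.1 (ha.eventually (gt_mem_nhds hη2))
    refine ⟨N, fun n hn m hm => ?_⟩
    rw [hmap _ ((hqm n).sub (hqm m)).aestronglyMeasurable]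
    refine (hqq n m).trans_lt ?_
    rw [← ENNReal.add_halves η]
    exact ENNReal.add_lt_add (hN n hn) (hN m hm))
  have hQm : AEStronglyMeasurable (Q ∘ π) μ := hQ.1.comp_measurable hπm
  have hconv : Tendsto (fun n => eLpNorm (g (φ n) - Q ∘ π) 1 μ) atTop (𝓝 0) := by
    rw [ENNReal.tendsto_nhds_zero]
    intro η hη
    have h1 : Tendsto (fun k => a k + eLpNorm (q k - Q) 1 ν) atTop (𝓝 0) := by
      simpa using ha.add hqQ
    obtain ⟨k, hk⟩ := (h1.eventually (gt_mem_nhds hη)).exists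
    have h2 := (hsa k).add_const (eLpNorm (q k - Q) 1 ν)
    filter_upwards [h2.eventually (gt_mem_nhds hk)] with n hn
    refine le_trans ?_ hn.le
    rw [hmap _ ((hqm k).aestronglyMeasurable.sub hQ.1), eLpNorm_one_eq_lintegral_enorm]
    refine le_trans ?_ (add_le_add (hs k n) le_rfl)
    rw [← lintegral_add_left (hgqm k n)]
    refine lintegral_mono fun x => ?_
    simp only [Pi.sub_apply, Function.comp_apply, ← edist_eq_enorm_sub]
    exact edist_triangle _ _ _
  obtain ⟨ψ, hψ, hψae⟩ := (tendstoInMeasure_of_tendsto_eLpNorm one_ne_zero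
    (fun n => (hgm (φ n)).aestronglyMeasurable) hQm hconv).exists_seq_tendsto_ae
  refine ⟨φ ∘ ψ, hφ.comp hψ, hQ.1.mk Q, hQ.1.stronglyMeasurable_mk.measurable, ?_⟩
  filter_upwards [hψae, ae_of_ae_map hπm.aemeasurable hQ.1.ae_eq_mk] with x hx hx'
  rw [← hx']
  exact hx

end PhaseCompactness

section Norms

lemma vnorm_nonneg (v : V3) : 0 ≤ vnorm v := Real.sqrt_nonneg _

lemma mnorm_nonneg (ξ : M33) : 0 ≤ mnorm ξ := Real.sqrt_nonneg _

lemma continuous_vnorm : Continuous vnorm := by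
  unfold vnorm; fun_prop

lemma continuous_mnorm : Continuous mnorm := by
  unfold mnorm; fun_prop

lemma norm_le_vnorm (v : V3) : ‖v‖ ≤ vnorm v := by
  refine (pi_norm_le_iff_of_nonneg (vnorm_nonneg v)).2 fun i => ?_
  exact Real.abs_le_sqrt
    (Finset.single_le_sum (f := fun i => v i ^ 2) (fun i _ => sq_nonneg _) (Finset.mem_univ i))

lemma vnorm_le_norm (v : V3) : vnorm v ≤ 3 * ‖v‖ := by
  refine Real.sqrt_le_iff.2 ⟨by positivity, ?_⟩
  have h1 : ∀ i, v i ^ 2 ≤ ‖v‖ ^ 2 := fun i => by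
    rw [← sq_abs]
    exact pow_le_pow_left₀ (abs_nonneg _) (norm_le_pi_norm v i) 2
  rw [Fin.sum_univ_three]
  nlinarith [h1 0, h1 1, h1 2, norm_nonneg v]

lemma norm_le_mnorm (ξ : M33) : ‖ξ‖ ≤ mnorm ξ := by
  refine (pi_norm_le_iff_of_nonneg (mnorm_nonneg ξ)).2 fun j => (norm_le_vnorm _).trans ?_
  exact Real.sqrt_le_sqrt (Finset.single_le_sum (f := fun j => ∑ i, ξ j i ^ 2)
    (fun i _ => Finset.sum_nonneg fun i _ => sq_nonneg _) (Finset.mem_univ j))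

lemma mnorm_le_norm (ξ : M33) : mnorm ξ ≤ 3 * ‖ξ‖ := by
  refine Real.sqrt_le_iff.2 ⟨by positivity, ?_⟩
  have h1 : ∀ j i, ξ j i ^ 2 ≤ ‖ξ‖ ^ 2 := fun j i => by
    rw [← sq_abs]
    exact pow_le_pow_left₀ (abs_nonneg _) ((norm_le_pi_norm (ξ j) i).trans (norm_le_pi_norm ξ j)) 2
  simp only [Fin.sum_univ_three]
  nlinarith [h1 0 0, h1 0 1, h1 0 2, h1 1 0, h1 1 1, h1 1 2, h1 2 0, h1 2 1, h1 2 2]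

end Norms

section RescaledGradient

lemma measurable_pd (e : Pt) (u : Pt → V3) : Measurable (pd e u) :=
  measurable_fderiv_apply_const ℝ u e

lemma measurable_gradh (h : ℝ) (u : Pt → V3) : Measurable (gradh h u) := by
  refine measurable_pi_lambda _ fun j => ?_
  fin_cases j
  · exact measurable_pd e1 u
  · exact measurable_pd e2 u
  · exact (measurable_pd e3 u).const_smul h⁻¹

lemma measurable_hessh (h : ℝ) (u : Pt → V3) : Measurable (hessh h u) := by
  have key : ∀ e f, Measurable fun x => vnorm (pd e (pd f u) x) := fun e f =>
    continuous_vnorm.measurable.comp (measurable_pd e _)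
  unfold hessh
  have h1 := key e1 e1
  have h2 := key e2 e2
  have h3 := key e3 e3
  have h4 := key e2 e1
  have h5 := key e3 e1
  have h6 := key e3 e2
  fun_prop

lemma hessh_nonneg (h : ℝ) (u : Pt → V3) (x : Pt) : 0 ≤ hessh h u x := by
  unfold hessh
  positivity

variable {U : Set Pt} {u : Pt → V3} {z : Pt}

lemma contDiffOn_pd (hU : IsOpen U) (hu : ContDiffOn ℝ 2 u U) (e : Pt) :
    ContDiffOn ℝ 1 (pd e u) U :=
  (hu.fderiv_of_isOpen hU (m := 1) (by norm_num)).clm_apply contDiffOn_const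

lemma contDiffOn_gradh (hU : IsOpen U) (hu : ContDiffOn ℝ 2 u U) (h : ℝ) :
    ContDiffOn ℝ 1 (gradh h u) U := by
  refine contDiffOn_pi.2 fun j => ?_
  fin_cases j
  · exact contDiffOn_pd hU hu e1
  · exact contDiffOn_pd hU hu e2
  · exact (contDiffOn_pd hU hu e3).const_smul h⁻¹

lemma eq_sum_smul_basis (w : Pt) : w = w.1 • e1 + w.2.1 • e2 + w.2.2 • e3 := by
  ext <;> simp [e1, e2, e3]

lemma fderiv_apply_eq_sum_pd (v : Pt → V3) (z w : Pt) :
    fderiv ℝ v z w = w.1 • pd e1 v z + w.2.1 • pd e2 v z + w.2.2 • pd e3 v z := by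
  conv_lhs => rw [eq_sum_smul_basis w]
  simp [pd]

lemma pd_pd_comm (hU : IsOpen U) (hu : ContDiffOn ℝ 2 u U) (hz : z ∈ U) (e f : Pt) :
    pd e (pd f u) z = pd f (pd e u) z := by
  have hc : ContDiffAt ℝ 2 u z := hu.contDiffAt (hU.mem_nhds hz)
  have hd : DifferentiableAt ℝ (fderiv ℝ u) z :=
    (hc.fderiv_right (m := 1) (by norm_num)).differentiableAt (by norm_num)
  have key : ∀ e f, pd e (pd f u) z = fderiv ℝ (fderiv ℝ u) z e f := fun e f => by
    have : HasFDerivAt (pd f u) ((fderiv ℝ (fderiv ℝ u) z).flip f) z := by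
      have h1 := hd.hasFDerivAt.clm_apply (hasFDerivAt_const f z)
      rwa [ContinuousLinearMap.comp_zero, zero_add] at h1
    change fderiv ℝ (pd f u) z e = _
    rw [this.fderiv]
    rfl
  rw [key, key]
  exact hc.isSymmSndFDerivAt (by simp) e f

lemma norm_fderiv_gradh_le (hU : IsOpen U) (hu : ContDiffOn ℝ 2 u U) (hz : z ∈ U) {h : ℝ}
    (hh : 0 < h) (w : Pt) : ‖fderiv ℝ (gradh h u) z w‖
      ≤ √(hessh h u z) * (|w.1| + |w.2.1| + h * |w.2.2|) := by
  set H := √(hessh h u z) with hHdef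
  have hle : ∀ (v : V3) (c : ℝ), 0 ≤ c → (c * vnorm v) ^ 2 ≤ hessh h u z → c * ‖v‖ ≤ H := by
    intro v c hc hv
    refine (mul_le_mul_of_nonneg_left (norm_le_vnorm v) hc).trans (Real.le_sqrt_of_sq_le hv)
  have hd : ∀ e, DifferentiableAt ℝ (pd e u) z := fun e =>
    ((contDiffOn_pd hU hu e).contDiffAt (hU.mem_nhds hz)).differentiableAt (by norm_num)
  have hD : DifferentiableAt ℝ (gradh h u) z :=
    ((contDiffOn_gradh hU hu h).contDiffAt (hU.mem_nhds hz)).differentiableAt (by norm_num)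
  have p1 : 0 ≤ (vnorm (pd e1 (pd e1 u) z)) ^ 2 := sq_nonneg _
  have p2 : 0 ≤ (vnorm (pd e2 (pd e2 u) z)) ^ 2 := sq_nonneg _
  have p3 : 0 ≤ (h⁻¹) ^ 4 * (vnorm (pd e3 (pd e3 u) z)) ^ 2 := by positivity
  have p4 : 0 ≤ (vnorm (pd e2 (pd e1 u) z)) ^ 2 := sq_nonneg _
  have p5 : 0 ≤ (h⁻¹) ^ 2 * (vnorm (pd e3 (pd e1 u) z)) ^ 2 := by positivity
  have p6 : 0 ≤ (h⁻¹) ^ 2 * (vnorm (pd e3 (pd e2 u) z)) ^ 2 := by positivity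
  have hH : 0 ≤ H := Real.sqrt_nonneg _
  have b11 : ‖pd e1 (pd e1 u) z‖ ≤ H := by
    have := hle (pd e1 (pd e1 u) z) 1 (by norm_num) (by rw [hessh]; nlinarith)
    linarith
  have b22 : ‖pd e2 (pd e2 u) z‖ ≤ H := by
    have := hle (pd e2 (pd e2 u) z) 1 (by norm_num) (by rw [hessh]; nlinarith)
    linarith
  have b21 : ‖pd e2 (pd e1 u) z‖ ≤ H := by
    have := hle (pd e2 (pd e1 u) z) 1 (by norm_num) (by rw [hessh]; nlinarith)
    linarith
  have b31 : h⁻¹ * ‖pd e3 (pd e1 u) z‖ ≤ H :=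
    hle _ _ (by positivity) (by rw [hessh]; nlinarith)
  have b32 : h⁻¹ * ‖pd e3 (pd e2 u) z‖ ≤ H :=
    hle _ _ (by positivity) (by rw [hessh]; nlinarith)
  have b33 : h⁻¹ ^ 2 * ‖pd e3 (pd e3 u) z‖ ≤ H :=
    hle _ _ (by positivity) (by rw [hessh]; nlinarith)
  have hsum : ∀ (v : Pt → V3), ‖fderiv ℝ v z w‖
      ≤ |w.1| * ‖pd e1 v z‖ + |w.2.1| * ‖pd e2 v z‖ + |w.2.2| * ‖pd e3 v z‖ := fun v => by
    rw [fderiv_apply_eq_sum_pd]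
    refine (norm_add₃_le).trans (le_of_eq ?_)
    simp only [norm_smul, Real.norm_eq_abs]
  have hcol : ∀ c : ℝ, ∀ e, 0 < c → c * ‖pd e1 (pd e u) z‖ ≤ H → c * ‖pd e2 (pd e u) z‖ ≤ H →
      c * (h⁻¹ * ‖pd e3 (pd e u) z‖) ≤ H → c * ‖fderiv ℝ (pd e u) z w‖
        ≤ H * (|w.1| + |w.2.1| + h * |w.2.2|) := by
    intro c e hc h1 h2 h3
    have h3' : c * ‖pd e3 (pd e u) z‖ ≤ h * H := by
      calc c * ‖pd e3 (pd e u) z‖ = h * (c * (h⁻¹ * ‖pd e3 (pd e u) z‖)) := by field_simp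
        _ ≤ h * H := by gcongr
    calc c * ‖fderiv ℝ (pd e u) z w‖
        ≤ c * (|w.1| * ‖pd e1 (pd e u) z‖ + |w.2.1| * ‖pd e2 (pd e u) z‖
            + |w.2.2| * ‖pd e3 (pd e u) z‖) := by gcongr; exact hsum _
      _ = |w.1| * (c * ‖pd e1 (pd e u) z‖) + |w.2.1| * (c * ‖pd e2 (pd e u) z‖)
            + |w.2.2| * (c * ‖pd e3 (pd e u) z‖) := by ring
      _ ≤ |w.1| * H + |w.2.1| * H + |w.2.2| * (h * H) := by gcongr
      _ = _ := by ring
  refine (pi_norm_le_iff_of_nonneg (by positivity)).2 fun j => ?_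
  have hj : fderiv ℝ (gradh h u) z w j = fderiv ℝ (fun x => gradh h u x j) z w := by
    rw [fderiv_apply hD]; rfl
  rw [hj]
  fin_cases j
  · have := hcol 1 e1 one_pos (by simpa using b11) (by simpa using b21) (by simpa using b31)
    rwa [one_mul] at this
  · have := hcol 1 e2 one_pos (by rw [one_mul, pd_pd_comm hU hu hz]; exact b21)
      (by simpa using b22) (by simpa using b32)
    rwa [one_mul] at this
  · have := hcol h⁻¹ e3 (by positivity) (by rwa [pd_pd_comm hU hu hz])
      (by rwa [pd_pd_comm hU hu hz]) (by rw [← mul_assoc, ← pow_two]; exact b33)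
    refine le_trans (le_of_eq ?_) this
    change ‖fderiv ℝ (fun x => h⁻¹ • pd e3 u x) z w‖ = _
    rw [fderiv_fun_const_smul (hd e3)]
    simp [norm_smul, abs_of_pos hh]

end RescaledGradient

section PhaseIndicator

lemma exists_phaseIndicator {W : M33 → ℝ} {A B : M33} (hWc : Continuous W)
    (hW : ∀ ξ, 0 ≤ W ξ) (hW0 : ∀ ξ, W ξ = 0 ↔ ξ = A ∨ ξ = B) (hAB : A ≠ B) :
    ∃ f : M33 → ℝ, ContDiff ℝ 1 f ∧ f A = 1 ∧ f B = 0 ∧ (∀ ξ, |f ξ| ≤ 1) ∧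
      ∃ C, 0 ≤ C ∧ ∀ ξ, ‖fderiv ℝ f ξ‖ ≤ C * √(W ξ) := by
  have hd : 0 < dist A B := dist_pos.2 hAB
  let f : ContDiffBump A := ⟨dist A B / 4, dist A B / 2, by linarith, by linarith⟩
  have hfc : ContDiff ℝ 1 f := f.contDiff
  set S := Metric.closedBall A (dist A B / 2) \ Metric.ball A (dist A B / 4) with hS
  have hSc : IsCompact S := (isCompact_closedBall _ _).diff Metric.isOpen_ball
  have hWpos : ∀ ξ ∈ S, 0 < W ξ := fun ξ hξ => by
    refine lt_of_le_of_ne (hW ξ) fun h => ?_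
    rcases (hW0 ξ).1 h.symm with rfl | rfl
    · exact hξ.2 (Metric.mem_ball_self (by linarith))
    · have := hξ.1
      rw [Metric.mem_closedBall, dist_comm] at this
      linarith
  obtain ⟨C, hC⟩ := hSc.bddAbove_image (f := fun ξ => ‖fderiv ℝ f ξ‖ / √(W ξ)) (by
    refine ContinuousOn.div ?_ ?_ fun ξ hξ => (Real.sqrt_pos.2 (hWpos ξ hξ)).ne'
    · exact (hfc.continuous_fderiv (by norm_num)).norm.continuousOn
    · exact hWc.sqrt.continuousOn)
  refine ⟨f, hfc, f.one_of_mem_closedBall (Metric.mem_closedBall_self (by positivity)),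
    f.zero_of_le_dist ?_, fun ξ => ?_, max C 0, le_max_right _ _, fun ξ => ?_⟩
  · change dist A B / 2 ≤ dist B A
    rw [dist_comm B A]; linarith
  · rw [abs_of_nonneg f.nonneg]; exact f.le_one
  · have hnn : 0 ≤ max C 0 * √(W ξ) := mul_nonneg (le_max_right _ _) (Real.sqrt_nonneg _)
    by_cases h1 : ξ ∈ Metric.ball A (dist A B / 4)
    · have h2 : f =ᶠ[𝓝 ξ] fun _ => (1 : ℝ) := f.eventuallyEq_one_of_mem_ball h1
      rw [h2.fderiv_eq]
      simpa using hnn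
    by_cases h2 : ξ ∈ Metric.closedBall A (dist A B / 2)
    · have h3 := hC (mem_image_of_mem _ (⟨h2, h1⟩ : ξ ∈ S))
      rw [div_le_iff₀ (Real.sqrt_pos.2 (hWpos ξ ⟨h2, h1⟩))] at h3
      exact h3.trans (mul_le_mul_of_nonneg_right (le_max_left _ _) (Real.sqrt_nonneg _))
    · have h3 : fderiv ℝ f ξ = 0 := by
        by_contra h4
        refine h2 ?_
        have h5 := support_fderiv_subset ℝ (Function.mem_support.2 h4)
        rwa [f.tsupport_eq] at h5
      rw [h3]
      simpa using hnn

lemma exists_subseq_tendsto_phaseIndicator {W : M33 → ℝ} (hW : ∀ ξ, 0 ≤ W ξ)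
    {ω : Set (ℝ × ℝ)} (hωo : IsOpen ω) (hωc : Convex ℝ ω) (hωb : Bornology.IsBounded ω)
    {h ε : ℕ → ℝ} (hh : ∀ n, 0 < h n) (hε : ∀ n, 0 < ε n) (hh0 : Tendsto h atTop (𝓝 0))
    (hWc : Continuous W)
    {u : ℕ → Pt → V3} (hu : ∀ n, ContDiffOn ℝ 2 (u n) (Om ω))
    {K : ℝ≥0∞} (hK : K ≠ ∞) (hF : ∀ n, F W (h n) (ε n) (u n) (Om ω) ≤ K)
    {f : M33 → ℝ} (hf : ContDiff ℝ 1 f) (hf1 : ∀ ξ, |f ξ| ≤ 1) {C : ℝ} (hC : 0 ≤ C)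
    (hfC : ∀ ξ, ‖fderiv ℝ f ξ‖ ≤ C * √(W ξ)) :
    ∃ φ : ℕ → ℕ, StrictMono φ ∧ ∃ q : ℝ × ℝ → ℝ, Measurable q ∧
      ∀ᵐ x ∂(volume.restrict (Om ω)),
        Tendsto (fun n => f (gradh (h (φ n)) (u (φ n)) x)) atTop (𝓝 (q (x.1, x.2.1))) := by
  have hO := isOpen_Om hωo
  have hGm : ∀ n, Measurable fun x =>
      ENNReal.ofReal ((ε n)⁻¹ * W (gradh (h n) (u n) x) + ε n * hessh (h n) (u n) x) := fun n =>
    (((hWc.measurable.comp (measurable_gradh _ _)).const_mul _).add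
      ((measurable_hessh _ _).const_mul _)).ennreal_ofReal
  refine exists_subseq_tendsto_planar (g := fun n x => f (gradh (h n) (u n) x)) hωo hωc hωb hh hh0
    (fun n => hf.comp_contDiffOn (contDiffOn_gradh hO (hu n) _))
    (fun n => hf.continuous.measurable.comp (measurable_gradh _ _)) (fun n x => hf1 _)
    (G := fun n x => ENNReal.ofReal C * ENNReal.ofReal
      ((ε n)⁻¹ * W (gradh (h n) (u n) x) + ε n * hessh (h n) (u n) x))
    (fun n => (hGm n).const_mul _) (fun n z hz w => ?_)
    (K := ENNReal.ofReal C * K) (by finiteness) (fun n => ?_)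
  · set D := gradh (h n) (u n) with hD
    have hDd : DifferentiableAt ℝ D z :=
      ((contDiffOn_gradh hO (hu n) _).contDiffAt (hO.mem_nhds hz)).differentiableAt (by norm_num)
    have hfd : DifferentiableAt ℝ f (D z) := hf.differentiable (by norm_num) _
    have hwn : 0 ≤ |w.1| + |w.2.1| + h n * |w.2.2| := by have := hh n; positivity
    rw [← ENNReal.ofReal_mul hC, ← ENNReal.ofReal_mul hwn, ← ofReal_norm]
    refine ENNReal.ofReal_le_ofReal ?_
    rw [show (fun x => f (D x)) = f ∘ D from rfl, fderiv_comp z hfd hDd]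
    calc ‖fderiv ℝ f (D z) (fderiv ℝ D z w)‖
        ≤ ‖fderiv ℝ f (D z)‖ * ‖fderiv ℝ D z w‖ := ContinuousLinearMap.le_opNorm _ _
      _ ≤ (C * √(W (D z))) * (√(hessh (h n) (u n) z) * (|w.1| + |w.2.1| + h n * |w.2.2|)) := by
          gcongr
          · exact hfC _
          · exact norm_fderiv_gradh_le hO (hu n) hz (hh n) w
      _ = (|w.1| + |w.2.1| + h n * |w.2.2|) * (C * (√(W (D z)) * √(hessh (h n) (u n) z))) := by
          ring
      _ ≤ _ := by
          gcongr
          have e := hε n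
          have h1 := Real.sq_sqrt (hW (D z))
          have h2 := Real.sq_sqrt (hessh_nonneg (h n) (u n) z)
          set a := √(W (D z))
          set b := √(hessh (h n) (u n) z)
          rw [← h1, ← h2]
          have ha : 0 ≤ a := Real.sqrt_nonneg _
          have hb : 0 ≤ b := Real.sqrt_nonneg _
          have h3 : (ε n)⁻¹ * a ^ 2 + ε n * b ^ 2 - a * b
              = (ε n)⁻¹ * ((a - ε n * b) ^ 2 + ε n * (a * b)) := by
            field_simp; ring
          have h4 : 0 ≤ (ε n)⁻¹ * ((a - ε n * b) ^ 2 + ε n * (a * b)) := by positivity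
          linarith
  · rw [lintegral_const_mul _ (hGm n)]
    gcongr
    exact hF n

end PhaseIndicator

section GradientConvergence

lemma tendsto_well {W : M33 → ℝ} {A B : M33} {p : ℝ} (hp : 1 ≤ p) (hWc : Continuous W)
    (hW0 : ∀ ξ, W ξ = 0 ↔ ξ = A ∨ ξ = B) {C : ℝ} (hC : 0 < C)
    (hcoer : ∀ ξ, C⁻¹ * mnorm ξ ^ p - C ≤ W ξ) {f : M33 → ℝ} (hf : Continuous f)
    (hfA : f A = 1) (hfB : f B = 0) {ξ : ℕ → M33} (hξ : Tendsto (fun n => W (ξ n)) atTop (𝓝 0))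
    {q : ℝ} (hq : Tendsto (fun n => f (ξ n)) atTop (𝓝 q)) :
    Tendsto ξ atTop (𝓝 (if q = 0 then B else A)) := by
  have hbdd : ∀ᶠ n in atTop, ξ n ∈ Metric.closedBall (0 : M33) (max 1 (C * (C + 1))) := by
    filter_upwards [hξ.eventually_le_const one_pos] with n hn
    have h1 : mnorm (ξ n) ^ p ≤ C * (C + 1) := by
      have h2 := hcoer (ξ n)
      have h3 : C⁻¹ * mnorm (ξ n) ^ p ≤ C + 1 := by linarith
      rwa [inv_mul_le_iff₀ hC] at h3
    rw [mem_closedBall_zero_iff]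
    refine (norm_le_mnorm _).trans ?_
    by_cases h4 : mnorm (ξ n) ≤ 1
    · exact h4.trans (le_max_left _ _)
    · refine le_max_of_le_right (le_trans ?_ h1)
      exact Real.self_le_rpow_of_one_le (not_le.1 h4).le hp
  refine (isCompact_closedBall _ _).tendsto_nhds_of_unique_mapClusterPt hbdd fun η _ hη => ?_
  have h1 : W η = 0 := by
    have h2 : ClusterPt (W η) (map (fun n => W (ξ n)) atTop) :=
      hη.continuousAt_comp hWc.continuousAt
    exact t2_iff_nhds.1 inferInstance (h2.mono hξ)
  have h3 : f η = q := by
    have h2 : ClusterPt (f η) (map (fun n => f (ξ n)) atTop) :=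
      hη.continuousAt_comp hf.continuousAt
    exact t2_iff_nhds.1 inferInstance (h2.mono hq)
  rcases (hW0 η).1 h1 with rfl | rfl
  · rw [← h3, hfA, if_neg one_ne_zero]
  · rw [← h3, hfB, if_pos rfl]

lemma exists_mnorm_sub_rpow_le {W : M33 → ℝ} {p : ℝ} (hp : 1 ≤ p) {C : ℝ}
    (hC : 0 < C) (hcoer : ∀ ξ, C⁻¹ * mnorm ξ ^ p - C ≤ W ξ) (R : ℝ) :
    ∃ a b : ℝ, 0 ≤ a ∧ 0 ≤ b ∧ ∀ ξ M : M33, ‖M‖ ≤ R → mnorm (ξ - M) ^ p ≤ a * W ξ + b := by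
  refine ⟨6 ^ p * C, 6 ^ p * (C * C + |R| ^ p), by positivity, by positivity, fun ξ M hM => ?_⟩
  have hp0 : 0 ≤ p := by linarith
  set m := max (mnorm ξ) |R| with hm
  have hm0 : 0 ≤ m := le_max_of_le_right (abs_nonneg _)
  have h1 : mnorm (ξ - M) ≤ 6 * m := by
    have h2 := norm_sub_le ξ M
    have h3 := norm_le_mnorm ξ
    have h4 := le_abs_self R
    have h5 := le_max_left (mnorm ξ) |R|
    have h6 := le_max_right (mnorm ξ) |R|
    have h7 := mnorm_le_norm (ξ - M)
    linarith
  have h2 : m ^ p ≤ mnorm ξ ^ p + |R| ^ p := by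
    have h3 : 0 ≤ mnorm ξ ^ p := Real.rpow_nonneg (mnorm_nonneg _) _
    have h4 : 0 ≤ |R| ^ p := by positivity
    rcases max_choice (mnorm ξ) |R| with h | h <;> rw [hm, h] <;> linarith
  have h3 : mnorm ξ ^ p ≤ C * (W ξ + C) := by
    have h4 : C⁻¹ * mnorm ξ ^ p ≤ W ξ + C := by linarith [hcoer ξ]
    rwa [inv_mul_le_iff₀ hC] at h4
  calc mnorm (ξ - M) ^ p ≤ (6 * m) ^ p := Real.rpow_le_rpow (mnorm_nonneg _) h1 hp0
    _ = 6 ^ p * m ^ p := Real.mul_rpow (by norm_num) hm0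
    _ ≤ 6 ^ p * (C * (W ξ + C) + |R| ^ p) := by gcongr; linarith
    _ = _ := by ring

lemma tendsto_lintegral_mnorm_sub_rpow {α : Type*} [MeasurableSpace α] {μ : Measure α}
    [IsFiniteMeasure μ] {W : M33 → ℝ} (hWc : Continuous W) (hW : ∀ ξ, 0 ≤ W ξ) {p : ℝ}
    (hp : 1 ≤ p) {C : ℝ} (hC : 0 < C) (hcoer : ∀ ξ, C⁻¹ * mnorm ξ ^ p - C ≤ W ξ)
    {D : ℕ → α → M33} (hD : ∀ n, Measurable (D n)) {M : α → M33} (hM : Measurable M) {R : ℝ}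
    (hMR : ∀ x, ‖M x‖ ≤ R)
    (hWD : Tendsto (fun n => ∫⁻ x, ENNReal.ofReal (W (D n x)) ∂μ) atTop (𝓝 0))
    (hDM : ∀ᵐ x ∂μ, Tendsto (fun n => D n x) atTop (𝓝 (M x))) :
    Tendsto (fun n => ∫⁻ x, ENNReal.ofReal (mnorm (D n x - M x) ^ p) ∂μ) atTop (𝓝 0) := by
  obtain ⟨a, b, ha, hb, hab⟩ := exists_mnorm_sub_rpow_le hp hC hcoer R
  have hXm : ∀ n, Measurable fun x => ENNReal.ofReal (mnorm (D n x - M x) ^ p) := fun n =>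
    ((continuous_mnorm.measurable.comp ((hD n).sub hM)).pow_const p).ennreal_ofReal
  have h1 : ∀ n, ∫⁻ x, ENNReal.ofReal (mnorm (D n x - M x) ^ p) ∂μ
      ≤ ENNReal.ofReal a * ∫⁻ x, ENNReal.ofReal (W (D n x)) ∂μ
        + ∫⁻ x, min (ENNReal.ofReal (mnorm (D n x - M x) ^ p)) (ENNReal.ofReal b) ∂μ := by
    intro n
    have hWm : Measurable fun x => ENNReal.ofReal (W (D n x)) :=
      (hWc.measurable.comp (hD n)).ennreal_ofReal
    rw [← lintegral_const_mul _ hWm,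
      ← lintegral_add_right _ ((hXm n).min measurable_const)]
    refine lintegral_mono fun x => ?_
    rcases le_total (mnorm (D n x - M x) ^ p) b with h | h
    · simp only [min_eq_left (ENNReal.ofReal_le_ofReal h)]
      exact le_add_self
    · simp only [min_eq_right (ENNReal.ofReal_le_ofReal h)]
      rw [← ENNReal.ofReal_mul ha, ← ENNReal.ofReal_add (mul_nonneg ha (hW _)) hb]
      exact ENNReal.ofReal_le_ofReal (hab _ _ (hMR x))
  have h2 : Tendsto (fun n => ∫⁻ x, min (ENNReal.ofReal (mnorm (D n x - M x) ^ p))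
      (ENNReal.ofReal b) ∂μ) atTop (𝓝 0) := by
    have h3 := tendsto_lintegral_of_dominated_convergence (μ := μ)
      (F := fun n x => min (ENNReal.ofReal (mnorm (D n x - M x) ^ p)) (ENNReal.ofReal b))
      (f := fun _ => 0) (fun _ => ENNReal.ofReal b)
      (fun n => (hXm n).min measurable_const)
      (fun n => Eventually.of_forall fun x => min_le_right _ _)
      (by simp [ENNReal.mul_eq_top]) (by
        filter_upwards [hDM] with x hx
        have h4 : Tendsto (fun n => mnorm (D n x - M x)) atTop (𝓝 0) := by
          have h0 := (continuous_mnorm.tendsto _).comp (hx.sub_const (M x))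
          rwa [sub_self, show mnorm 0 = 0 by simp [mnorm]] at h0
        have h5 := h4.rpow_const (p := p) (Or.inr (by linarith))
        rw [Real.zero_rpow (by linarith)] at h5
        have h6 := (ENNReal.tendsto_ofReal h5).min (tendsto_const_nhds (x := ENNReal.ofReal b))
        simpa using h6)
    simpa using h3
  have h4 : Tendsto (fun n => ENNReal.ofReal a * ∫⁻ x, ENNReal.ofReal (W (D n x)) ∂μ) atTop
      (𝓝 0) := by
    simpa using ENNReal.Tendsto.const_mul hWD (Or.inr ENNReal.ofReal_ne_top)
  have h5 := h4.add h2
  rw [add_zero] at h5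
  exact tendsto_of_tendsto_of_tendsto_of_le_of_le tendsto_const_nhds h5 (fun _ => zero_le) h1

lemma measurable_Mfun {A B : M33} {E : Set (ℝ × ℝ)} (hE : MeasurableSet E) :
    Measurable (Mfun A B E) := by
  classical
  unfold Mfun
  exact Measurable.ite hE measurable_const measurable_const

lemma norm_Mfun_le (A B : M33) (E : Set (ℝ × ℝ)) (y : ℝ × ℝ) :
    ‖Mfun A B E y‖ ≤ max ‖A‖ ‖B‖ := by
  unfold Mfun
  split_ifs
  · exact le_max_right _ _
  · exact le_max_left _ _

lemma lintegral_W_gradh_le {W : M33 → ℝ} (hWc : Continuous W) {h ε : ℝ}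
    (hε : 0 < ε) {u : Pt → V3} {S : Set Pt} {K : ℝ≥0∞} (hF : F W h ε u S ≤ K) :
    ∫⁻ x in S, ENNReal.ofReal (W (gradh h u x)) ≤ ENNReal.ofReal ε * K := by
  calc ∫⁻ x in S, ENNReal.ofReal (W (gradh h u x))
      ≤ ∫⁻ x in S, ENNReal.ofReal ε *
          ENNReal.ofReal (ε⁻¹ * W (gradh h u x) + ε * hessh h u x) := by
        refine lintegral_mono fun x => ?_
        rw [← ENNReal.ofReal_mul hε.le]
        refine ENNReal.ofReal_le_ofReal ?_
        have h1 := hessh_nonneg h u x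
        rw [mul_add, mul_inv_cancel_left₀ hε.ne']
        have : 0 ≤ ε * (ε * hessh h u x) := by positivity
        linarith
    _ = ENNReal.ofReal ε * F W h ε u S := lintegral_const_mul _
        (((hWc.measurable.comp (measurable_gradh _ _)).const_mul _).add
          ((measurable_hessh _ _).const_mul _)).ennreal_ofReal
    _ ≤ _ := by gcongr

lemma exists_subseq_gradh_tendsto {p : ℝ} (hp : 1 ≤ p) {A B : M33} {W : M33 → ℝ}
    (hWc : Continuous W) (hW : ∀ ξ, 0 ≤ W ξ) (hW0 : ∀ ξ, W ξ = 0 ↔ ξ = A ∨ ξ = B) (hAB : A ≠ B)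
    {C : ℝ} (hC : 0 < C) (hcoer : ∀ ξ, C⁻¹ * mnorm ξ ^ p - C ≤ W ξ)
    {ω : Set (ℝ × ℝ)} (hωo : IsOpen ω) (hωc : Convex ℝ ω) (hωb : Bornology.IsBounded ω)
    {h ε : ℕ → ℝ} (hh : ∀ n, 0 < h n) (hε : ∀ n, 0 < ε n) (hh0 : Tendsto h atTop (𝓝 0))
    (hε0 : Tendsto ε atTop (𝓝 0)) {u : ℕ → Pt → V3} (hu : ∀ n, ContDiffOn ℝ 2 (u n) (Om ω))
    {K : ℝ≥0∞} (hK : K ≠ ∞) (hF : ∀ n, F W (h n) (ε n) (u n) (Om ω) ≤ K) :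
    ∃ φ : ℕ → ℕ, StrictMono φ ∧ ∃ E : Set (ℝ × ℝ), MeasurableSet E ∧ E ⊆ ω ∧
      Tendsto (fun n => ∫⁻ x in Om ω, ENNReal.ofReal
        ((mnorm (gradh (h (φ n)) (u (φ n)) x - Mfun A B E (x.1, x.2.1))) ^ p)) atTop (𝓝 0) := by
  set μ := volume.restrict (Om ω) with hμ
  have hμfin : IsFiniteMeasure μ := ⟨by simpa [μ] using (volume_Om_ne_top hωb).lt_top⟩
  obtain ⟨f, hf, hfA, hfB, hf1, C', hC', hfC⟩ := exists_phaseIndicator hWc hW hW0 hAB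
  obtain ⟨φ, hφ, q, hq, hlim⟩ := exists_subseq_tendsto_phaseIndicator hW hωo hωc hωb hh hε hh0 hWc
    hu hK hF hf hf1 hC' hfC
  have hWm : ∀ n, Measurable fun x => W (gradh (h n) (u n) x) := fun n =>
    hWc.measurable.comp (measurable_gradh _ _)
  have hW1 : Tendsto (fun n => ∫⁻ x, ENNReal.ofReal (W (gradh (h n) (u n) x)) ∂μ) atTop
      (𝓝 0) := by
    have h1 : Tendsto (fun n => ENNReal.ofReal (ε n) * K) atTop (𝓝 0) := by
      simpa using ENNReal.Tendsto.mul_const (ENNReal.tendsto_ofReal hε0) (Or.inr hK)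
    exact tendsto_of_tendsto_of_tendsto_of_le_of_le tendsto_const_nhds h1 (fun _ => zero_le)
      fun n => lintegral_W_gradh_le hWc (hε n) (hF n)
  have hmeas : TendstoInMeasure μ (fun n x => W (gradh (h (φ n)) (u (φ n)) x)) atTop
      (fun _ => 0) := by
    refine tendstoInMeasure_of_tendsto_eLpNorm one_ne_zero
      (fun n => (hWm _).aestronglyMeasurable) aestronglyMeasurable_const ?_
    refine (hW1.comp hφ.tendsto_atTop).congr fun n => ?_
    rw [eLpNorm_one_eq_lintegral_enorm]
    refine lintegral_congr fun x => ?_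
    simp [Real.enorm_of_nonneg (hW _)]
  obtain ⟨ψ, hψ, hWae⟩ := hmeas.exists_seq_tendsto_ae
  set E : Set (ℝ × ℝ) := q ⁻¹' {0} ∩ ω with hE
  have hEm : MeasurableSet E := (hq (measurableSet_singleton 0)).inter hωo.measurableSet
  refine ⟨φ ∘ ψ, hφ.comp hψ, E, hEm, inter_subset_right, ?_⟩
  refine tendsto_lintegral_mnorm_sub_rpow (μ := μ) hWc hW hp hC hcoer
    (D := fun n => gradh (h (φ (ψ n))) (u (φ (ψ n)))) (fun n => measurable_gradh _ _)
    (M := fun x => Mfun A B E (x.1, x.2.1)) ((measurable_Mfun hEm).comp measurable_planar)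
    (fun x => norm_Mfun_le A B E _) (hW1.comp (hφ.comp hψ).tendsto_atTop) ?_
  filter_upwards [hlim, hWae, ae_restrict_mem (isOpen_Om hωo).measurableSet] with x hx1 hx2 hx3
  have h1 := tendsto_well hp hWc hW0 hC hcoer hf.continuous hfA hfB hx2
    (hx1.comp hψ.tendsto_atTop)
  have h2 : Mfun A B E (x.1, x.2.1) = if q (x.1, x.2.1) = 0 then B else A := by
    have : (x.1, x.2.1) ∈ E ↔ q (x.1, x.2.1) = 0 := ⟨fun h => h.1, fun h => ⟨h, hx3.1⟩⟩
    simp only [Mfun, this]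
  rw [h2]
  exact h1

end GradientConvergence

section StrongLimit

lemma eLpNorm_ofReal_eq {α V : Type*} [MeasurableSpace α] {μ : Measure α} [NormedAddCommGroup V]
    {p : ℝ} (hp : 0 < p) (f : α → V) :
    eLpNorm f (ENNReal.ofReal p) μ = (∫⁻ x, ‖f x‖ₑ ^ p ∂μ) ^ (1 / p) := by
  rw [eLpNorm_eq_lintegral_rpow_enorm_toReal (by simpa using hp) ENNReal.ofReal_ne_top,
    ENNReal.toReal_ofReal hp.le]

lemma add_rpow_le_two_rpow {p : ℝ} (hp : 0 ≤ p) (a b : ℝ≥0∞) :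
    (a + b) ^ p ≤ 2 ^ p * (a ^ p + b ^ p) := by
  have h1 : a + b ≤ 2 * max a b := by
    rw [two_mul]
    exact add_le_add (le_max_left _ _) (le_max_right _ _)
  calc (a + b) ^ p ≤ (2 * max a b) ^ p := by gcongr
    _ = 2 ^ p * max a b ^ p := ENNReal.mul_rpow_of_nonneg _ _ hp
    _ ≤ _ := by
      gcongr
      rcases max_choice a b with h | h <;> rw [h]
      · exact le_self_add
      · exact le_add_self

variable {E V : Type*} [NormedAddCommGroup E] [NormedSpace ℝ E] [FiniteDimensional ℝ E]
  [MeasurableSpace E] [BorelSpace E] (μ : Measure E) [μ.IsAddHaarMeasure]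
  [NormedAddCommGroup V] [NormedSpace ℝ V] [CompleteSpace V] [SecondCountableTopology V]

/-- If the gradients of a sequence of maps on a bounded convex open set converge strongly, then so
do the maps themselves, up to subtraction of their averages. -/
lemma exists_tendsto_sub_average {p : ℝ} (hp : 1 ≤ p) {U : Set E} (hU : IsOpen U)
    (hUc : Convex ℝ U) (hUfin : μ U ≠ ∞) {R : ℝ≥0∞} (hR : R ≠ ∞)
    (hUR : ∀ x ∈ U, ∀ y ∈ U, ‖y - x‖ₑ ≤ R) {u : ℕ → E → V} (hu : ∀ n, ContDiffOn ℝ 1 (u n) U)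
    {N : E → E → V} {L : ℝ≥0∞} (hL : L ≠ ∞) (hN : ∀ z w, ‖N z w‖ₑ ≤ L * ‖w‖ₑ)
    {Z : ℕ → E → ℝ≥0∞} (hZ : ∀ n, Measurable (Z n))
    (huZ : ∀ n, ∀ z ∈ U, ∀ w, ‖fderiv ℝ (u n) z w - N z w‖ₑ ≤ ‖w‖ₑ * Z n z)
    (hZfin : ∀ n, ∫⁻ x in U, Z n x ^ p ∂μ ≠ ∞)
    (hZ0 : Tendsto (fun n => ∫⁻ x in U, Z n x ^ p ∂μ) atTop (𝓝 0)) :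
    (∀ n, MemLp (u n) (ENNReal.ofReal p) (μ.restrict U)) ∧
      ∃ w : E → V, MemLp w (ENNReal.ofReal p) (μ.restrict U) ∧
        Tendsto (fun n => eLpNorm ((fun x => u n x - ⨍ y in U, u n y ∂μ) - w)
          (ENNReal.ofReal p) (μ.restrict U)) atTop (𝓝 0) := by
  have hp0 : 0 < p := by linarith
  have hp1 : 1 ≤ ENNReal.ofReal p := by
    rw [← ENNReal.ofReal_one]; exact ENNReal.ofReal_le_ofReal hp
  have : IsFiniteMeasure (μ.restrict U) := ⟨by simpa using hUfin.lt_top⟩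
  have hd : ∀ n, ∀ z ∈ U, DifferentiableAt ℝ (u n) z := fun n z hz =>
    ((hu n).contDiffAt (hU.mem_nhds hz)).differentiableAt (by norm_num)
  have hmem : ∀ n, MemLp (u n) (ENNReal.ofReal p) (μ.restrict U) := fun n => by
    refine memLp_of_fderiv_bound μ hp hU subset_rfl hU.measurableSet hUc hUfin (hu n)
      (G := fun z => R * (Z n z + L)) (((hZ n).add_const _).const_mul _)
      (fun x hx y hy z hz => ?_) ?_
    · calc ‖fderiv ℝ (u n) z (y - x)‖ₑ
          = ‖(fderiv ℝ (u n) z (y - x) - N z (y - x)) + N z (y - x)‖ₑ := by rw [sub_add_cancel]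
        _ ≤ ‖y - x‖ₑ * Z n z + L * ‖y - x‖ₑ :=
          (enorm_add_le _ _).trans (add_le_add (huZ n z hz _) (hN _ _))
        _ = ‖y - x‖ₑ * (Z n z + L) := by ring
        _ ≤ _ := by gcongr; exact hUR x hx y hy
    · refine ne_top_of_le_ne_top ?_ (lintegral_mono (g := fun z =>
        R ^ p * (2 ^ p * (Z n z ^ p + L ^ p))) fun z => ?_)
      · rw [lintegral_const_mul _ (by fun_prop), lintegral_const_mul _ (by fun_prop),
          lintegral_add_right _ measurable_const]
        have h1 := hZfin n
        have h2 : L ^ p ≠ ∞ := ENNReal.rpow_ne_top_of_nonneg hp0.le hL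
        have h3 : R ^ p ≠ ∞ := ENNReal.rpow_ne_top_of_nonneg hp0.le hR
        have h4 : (2 : ℝ≥0∞) ^ p ≠ ∞ := ENNReal.rpow_ne_top_of_nonneg hp0.le (by simp)
        have h5 : ∫⁻ _ in U, L ^ p ∂μ ≠ ∞ := by simp [ENNReal.mul_eq_top, h2, hUfin]
        finiteness
      · dsimp only
        rw [ENNReal.mul_rpow_of_nonneg _ _ hp0.le]
        gcongr
        exact add_rpow_le_two_rpow hp0.le _ _
  have hint : ∀ n, IntegrableOn (u n) U μ := fun n => (hmem n).integrable hp1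
  refine ⟨hmem, exists_tendsto_eLpNorm_of_cauchy hp1 (fun n => (hmem n).sub (memLp_const _))
    fun η hη => ?_⟩
  set c : ℝ≥0∞ := 2 ^ Module.finrank ℝ E * (R ^ p * 2 ^ p) with hc
  have hcfin : c ≠ ∞ := by
    have h3 : R ^ p ≠ ∞ := ENNReal.rpow_ne_top_of_nonneg hp0.le hR
    have h4 : (2 : ℝ≥0∞) ^ p ≠ ∞ := ENNReal.rpow_ne_top_of_nonneg hp0.le (by simp)
    finiteness
  have key : ∀ n m, eLpNorm ((fun x => u n x - ⨍ y in U, u n y ∂μ)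
      - fun x => u m x - ⨍ y in U, u m y ∂μ) (ENNReal.ofReal p) (μ.restrict U)
      ≤ (c * ((∫⁻ x in U, Z n x ^ p ∂μ) + ∫⁻ x in U, Z m x ^ p ∂μ)) ^ (1 / p) := by
    intro n m
    rw [eLpNorm_ofReal_eq hp0]
    gcongr
    have h1 := lintegral_enorm_sub_average_rpow_le μ hp hU subset_rfl hU.measurableSet hUc hUfin
      ((hu n).sub (hu m)) (f := u n - u m) (G := fun z => R * (Z n z + Z m z))
      (((hZ n).add (hZ m)).const_mul _)
      (fun x hx y hy z hz => by
        rw [fderiv_sub (hd n z hz) (hd m z hz)]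
        calc ‖(fderiv ℝ (u n) z - fderiv ℝ (u m) z) (y - x)‖ₑ
            = ‖(fderiv ℝ (u n) z (y - x) - N z (y - x))
                - (fderiv ℝ (u m) z (y - x) - N z (y - x))‖ₑ := by
              rw [sub_sub_sub_cancel_right]; rfl
          _ ≤ ‖y - x‖ₑ * Z n z + ‖y - x‖ₑ * Z m z :=
            enorm_sub_le.trans (add_le_add (huZ n z hz _) (huZ m z hz _))
          _ = ‖y - x‖ₑ * (Z n z + Z m z) := by ring
          _ ≤ _ := by gcongr; exact hUR x hx y hy)
      ((hint n).sub (hint m))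
    calc ∫⁻ x in U, ‖((fun x => u n x - ⨍ y in U, u n y ∂μ)
          - fun x => u m x - ⨍ y in U, u m y ∂μ) x‖ₑ ^ p ∂μ
        = ∫⁻ x in U, ‖(u n - u m) x - ⨍ y in U, (u n - u m) y ∂μ‖ₑ ^ p ∂μ := by
          have h2 : ⨍ y in U, (u n - u m) y ∂μ = ⨍ y in U, u n y ∂μ - ⨍ y in U, u m y ∂μ := by
            simp only [setAverage_eq, Pi.sub_apply]
            rw [integral_sub (hint n) (hint m), smul_sub]
          rw [h2]
          simp only [Pi.sub_apply]
          refine lintegral_congr fun x => ?_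
          rw [sub_sub_sub_comm]
      _ ≤ _ := h1
      _ ≤ 2 ^ Module.finrank ℝ E * ∫⁻ x in U, R ^ p * (2 ^ p * (Z n x ^ p + Z m x ^ p)) ∂μ := by
          gcongr with x
          rw [ENNReal.mul_rpow_of_nonneg _ _ hp0.le]
          gcongr
          exact add_rpow_le_two_rpow hp0.le _ _
      _ = _ := by
          have := hZ n
          have := hZ m
          rw [lintegral_const_mul _ (by fun_prop), lintegral_const_mul _ (by fun_prop),
            lintegral_add_left (by fun_prop), hc]
          ring
  have hlim : Tendsto (fun q : ℕ × ℕ => (c * ((∫⁻ x in U, Z q.1 x ^ p ∂μ)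
      + ∫⁻ x in U, Z q.2 x ^ p ∂μ)) ^ (1 / p)) (atTop ×ˢ atTop) (𝓝 0) := by
    have h1 := (hZ0.comp (tendsto_fst (g := atTop (α := ℕ)))).add
      (hZ0.comp (tendsto_snd (f := atTop (α := ℕ))))
    have h2 := (ENNReal.Tendsto.const_mul (a := c) h1 (Or.inr hcfin)).ennrpow_const (1 / p)
    simpa [hp0] using h2
  have h3 := hlim.eventually (gt_mem_nhds hη)
  rw [prod_atTop_atTop_eq] at h3
  obtain ⟨⟨a, b⟩, hab⟩ := eventually_atTop.1 h3
  exact ⟨max a b, fun n hn m hm => (key n m).trans_lt (hab (n, m)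
    ⟨(le_max_left _ _).trans hn, (le_max_right _ _).trans hm⟩)⟩

end StrongLimit

section LipschitzLimit

section
variable {E V : Type*} [NormedAddCommGroup E] [NormedSpace ℝ E] [FiniteDimensional ℝ E]
  [MeasurableSpace E] [BorelSpace E] (μ : Measure E) [μ.IsAddHaarMeasure]
  [NormedAddCommGroup V] [NormedSpace ℝ V]

lemma ae_ae_enorm_sub_le_of_tendsto {U : Set E} (hU : IsOpen U)
    (hUc : Convex ℝ U) (hUfin : μ U ≠ ∞) {R : ℝ≥0∞} (hR : R ≠ ∞)
    (hUR : ∀ x ∈ U, ∀ y ∈ U, ‖y - x‖ₑ ≤ R) {u : ℕ → E → V} (hu : ∀ n, ContDiffOn ℝ 1 (u n) U)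
    {N : E → E → V} {κ : E → ℝ≥0∞} (hN : ∀ z w, ‖N z w‖ₑ ≤ κ w)
    {Z : ℕ → E → ℝ≥0∞} (hZ : ∀ n, Measurable (Z n))
    (huZ : ∀ n, ∀ z ∈ U, ∀ w, ‖fderiv ℝ (u n) z w - N z w‖ₑ ≤ ‖w‖ₑ * Z n z)
    (hZ0 : Tendsto (fun n => ∫⁻ x in U, Z n x ∂μ) atTop (𝓝 0)) {w : E → V}
    (hw : ∀ᵐ x ∂(μ.restrict U), Tendsto (fun n => u n x) atTop (𝓝 (w x))) :
    ∀ᵐ x ∂(μ.restrict U), ∀ᵐ y ∂(μ.restrict U), ‖w y - w x‖ₑ ≤ κ (y - x) := by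
  have : IsFiniteMeasure (μ.restrict U) := ⟨by simpa using hUfin.lt_top⟩
  set a : ℕ → E → E → ℝ≥0∞ := fun n x y => ∫⁻ t in Icc (0 : ℝ) 1, Z n (x + t • (y - x)) with ha
  have ham : ∀ n, Measurable (Function.uncurry (a n)) := fun n => by
    have h1 : Measurable fun q : (E × E) × ℝ => Z n (q.1.1 + q.2 • (q.1.2 - q.1.1)) :=
      (hZ n).comp (by fun_prop)
    exact h1.lintegral_prod_right'
  have ham' : ∀ n x, Measurable (a n x) := fun n x => (ham n).comp measurable_prodMk_left
  have hbm : ∀ n, Measurable fun x => ∫⁻ y in U, a n x y ∂μ := fun n => (ham n).lintegral_prod_right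
  have hlim : Tendsto (fun n => ∫⁻ x in U, ∫⁻ y in U, a n x y ∂μ ∂μ) atTop (𝓝 0) := by
    have h1 : Tendsto (fun n => 2 ^ Module.finrank ℝ E * μ U * ∫⁻ x in U, Z n x ∂μ) atTop
        (𝓝 0) := by
      have h2 : 2 ^ Module.finrank ℝ E * μ U ≠ ∞ := by finiteness
      simpa using ENNReal.Tendsto.const_mul hZ0 (Or.inr h2)
    exact tendsto_of_tendsto_of_tendsto_of_le_of_le tendsto_const_nhds h1 (fun _ => zero_le)
      fun n => lintegral_segments_le μ hU.measurableSet hUc (hZ n)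
  have hzero : ∫⁻ x in U, ∫⁻ y in U, liminf (fun n => a n x y) atTop ∂μ ∂μ = 0 := by
    refine le_antisymm ?_ zero_le
    calc ∫⁻ x in U, ∫⁻ y in U, liminf (fun n => a n x y) atTop ∂μ ∂μ
        ≤ ∫⁻ x in U, liminf (fun n => ∫⁻ y in U, a n x y ∂μ) atTop ∂μ :=
          lintegral_mono fun x => lintegral_liminf_le fun n => ham' n x
      _ ≤ liminf (fun n => ∫⁻ x in U, ∫⁻ y in U, a n x y ∂μ ∂μ) atTop :=
          lintegral_liminf_le hbm
      _ = 0 := hlim.liminf_eq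
  have hlm : Measurable fun q : E × E => liminf (fun n => a n q.1 q.2) atTop := by
    have ham2 : ∀ n, Measurable fun q : E × E => a n q.1 q.2 := ham
    clear_value a
    fun_prop
  have hlm' : ∀ x, Measurable fun y => liminf (fun n => a n x y) atTop := fun x => by
    clear_value a
    fun_prop
  rw [lintegral_eq_zero_iff hlm.lintegral_prod_right'] at hzero
  filter_upwards [hzero, hw, ae_restrict_mem hU.measurableSet] with x hx1 hx2 hxU
  change ∫⁻ y in U, liminf (fun n => a n x y) atTop ∂μ = 0 at hx1
  rw [lintegral_eq_zero_iff (hlm' x)] at hx1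
  filter_upwards [hx1, hw, ae_restrict_mem hU.measurableSet] with y hy1 hy2 hyU
  change liminf (fun n => a n x y) atTop = 0 at hy1
  have hseg : ∀ n, ‖u n y - u n x‖ₑ ≤ κ (y - x) + R * a n x y := fun n => by
    have hsub := hUc.segment_subset hxU hyU
    calc ‖u n y - u n x‖ₑ
        ≤ ∫⁻ t in Icc (0 : ℝ) 1, ‖fderiv ℝ (u n) (x + t • (y - x)) (y - x)‖ₑ :=
          enorm_sub_le_lintegral_fderiv_segment hU (hu n) hsub
      _ ≤ ∫⁻ t in Icc (0 : ℝ) 1, (κ (y - x) + R * Z n (x + t • (y - x))) := by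
          refine setLIntegral_mono' measurableSet_Icc fun t ht => ?_
          have hz : x + t • (y - x) ∈ U := hsub (by rw [segment_eq_image']; exact ⟨t, ht, rfl⟩)
          set z := x + t • (y - x)
          calc ‖fderiv ℝ (u n) z (y - x)‖ₑ
              = ‖N z (y - x) + (fderiv ℝ (u n) z (y - x) - N z (y - x))‖ₑ := by
                rw [add_sub_cancel]
            _ ≤ κ (y - x) + ‖y - x‖ₑ * Z n z :=
              (enorm_add_le _ _).trans (add_le_add (hN _ _) (huZ n z hz _))
            _ ≤ _ := by gcongr; exact hUR x hxU y hyU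
      _ = κ (y - x) + R * a n x y := by
          have h1 : Measurable fun t : ℝ => Z n (x + t • (y - x)) := (hZ n).comp (by fun_prop)
          rw [lintegral_add_left measurable_const, lintegral_const_mul _ h1]
          simp [ha]
  have hsmall : ∀ k : ℕ, ‖w y - w x‖ₑ ≤ κ (y - x) + R * (k : ℝ≥0∞)⁻¹ := fun k => by
    refine le_of_tendsto_of_frequently (hy2.sub hx2).enorm ?_
    have h1 : ∃ᶠ n in atTop, a n x y < (k : ℝ≥0∞)⁻¹ := by
      refine frequently_lt_of_liminf_lt (by isBoundedDefault) ?_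
      rw [hy1]
      simp
    refine h1.mono fun n hn => (hseg n).trans ?_
    gcongr
  have hk : Tendsto (fun k : ℕ => κ (y - x) + R * (k : ℝ≥0∞)⁻¹) atTop (𝓝 (κ (y - x))) := by
    simpa using (ENNReal.Tendsto.const_mul ENNReal.tendsto_inv_nat_nhds_zero
      (Or.inr hR)).const_add (κ (y - x))
  exact ge_of_tendsto' hk hsmall

end

lemma exists_lipschitz_planar_ae_eq {ω : Set (ℝ × ℝ)} (hωo : IsOpen ω) {w : Pt → V3} {L : ℝ≥0}
    (hw : ∀ᵐ x ∂(volume.restrict (Om ω)), ∀ᵐ y ∂(volume.restrict (Om ω)),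
      ‖w y - w x‖ ≤ L * ‖((y - x).1, (y - x).2.1)‖) :
    ∃ v : ℝ × ℝ → V3, LipschitzWith L v ∧
      ∀ᵐ x ∂(volume.restrict (Om ω)), w x = v (x.1, x.2.1) := by
  have hO := isOpen_Om hωo
  set P : Pt → Pt → Prop := fun x y => ‖w y - w x‖ ≤ L * ‖((y - x).1, (y - x).2.1)‖ with hP
  set S : Set Pt := {x | x ∈ Om ω ∧ ∀ᵐ y ∂(volume.restrict (Om ω)), P x y} with hS
  have hS1 : ∀ᵐ x ∂(volume.restrict (Om ω)), x ∈ S := by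
    filter_upwards [hw, ae_restrict_mem hO.measurableSet] with x h1 h2
    exact ⟨h2, h1⟩
  have hpl : ∀ x y : Pt, ‖((y - x).1, (y - x).2.1)‖ ≤ ‖y - x‖ := fun x y => by
    simp only [Prod.norm_def]
    exact max_le_max le_rfl (le_max_left _ _)
  have hS2 : ∀ x ∈ S, ∀ y ∈ S, ‖w y - w x‖ ≤ L * ‖((y - x).1, (y - x).2.1)‖ := by
    intro x hx y hy
    have hδ : ∀ δ > 0, ‖w y - w x‖ ≤ L * ‖((y - x).1, (y - x).2.1)‖ + 2 * L * δ := by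
      intro δ hδ
      have hne : ∃ᵐ z ∂(volume.restrict (Om ω)), z ∈ Metric.ball x δ := by
        rw [frequently_ae_iff, ofPred_mem_eq,
          Measure.restrict_apply Metric.isOpen_ball.measurableSet]
        exact ((Metric.isOpen_ball.inter hO).measure_pos volume
          ⟨x, Metric.mem_ball_self hδ, hx.1⟩).ne'
      obtain ⟨z, hz, hzx, hzy⟩ := (hne.and_eventually (hx.2.and hy.2)).exists
      have h1 : ‖z - x‖ ≤ δ := by rw [← dist_eq_norm]; exact (Metric.mem_ball.1 hz).le
      have h2 : ‖((z - x).1, (z - x).2.1)‖ ≤ δ := (hpl x z).trans h1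
      have h3 : ‖((z - y).1, (z - y).2.1)‖ ≤ δ + ‖((y - x).1, (y - x).2.1)‖ := by
        have : ((z - y).1, (z - y).2.1) = ((z - x).1, (z - x).2.1) - ((y - x).1, (y - x).2.1) := by
          ext <;> simp
        rw [this]
        exact (norm_sub_le _ _).trans (by gcongr)
      calc ‖w y - w x‖ = ‖(w z - w x) - (w z - w y)‖ := by congr 1; abel
        _ ≤ ‖w z - w x‖ + ‖w z - w y‖ := norm_sub_le _ _
        _ ≤ L * δ + L * (δ + ‖((y - x).1, (y - x).2.1)‖) :=
          add_le_add (hzx.trans (by gcongr)) (hzy.trans (by gcongr))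
        _ = _ := by ring
    refine le_of_forall_pos_le_add fun η hη => ?_
    have h1 := hδ (η / (2 * L + 1)) (by positivity)
    have h2 : 2 * L * (η / (2 * L + 1)) ≤ η := by
      rw [mul_div_assoc', div_le_iff₀ (by positivity)]
      nlinarith [L.2]
    linarith
  choose! σ hσ1 hσ2 using fun (y : ℝ × ℝ)
    (hy : y ∈ Set.image (fun x : Pt => (x.1, x.2.1)) S) => hy
  have hlip : LipschitzOnWith L (fun y => w (σ y))
      (Set.image (fun x : Pt => (x.1, x.2.1)) S) := by
    refine LipschitzOnWith.of_dist_le_mul fun y hy z hz => ?_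
    rw [dist_eq_norm, dist_eq_norm]
    refine (hS2 _ (hσ1 z hz) _ (hσ1 y hy)).trans (le_of_eq ?_)
    have h1 := hσ2 y hy
    have h2 := hσ2 z hz
    dsimp only at h1 h2
    congr 2
    conv_rhs => rw [← h1, ← h2]
    rfl
  obtain ⟨v, hv, hvw⟩ := hlip.extend_pi
  refine ⟨v, hv, ?_⟩
  filter_upwards [hS1] with x hx
  have hx' := mem_image_of_mem (fun x : Pt => (x.1, x.2.1)) hx
  have h1 := hvw hx'
  have h2 := hS2 _ (hσ1 _ hx') x hx
  have h3 := hσ2 _ hx'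
  dsimp only at h1 h3
  have h4 : ((x - σ (x.1, x.2.1)).1, (x - σ (x.1, x.2.1)).2.1) = (0 : ℝ × ℝ) := by
    rw [Prod.mk.injEq] at h3
    ext
    · simp [h3.1]
    · simp [h3.2]
  rw [h4, norm_zero, mul_zero, norm_le_zero_iff, sub_eq_zero] at h2
  rw [h2]
  exact h1

end LipschitzLimit

section WeakDerivative

variable {E : Type*} [NormedAddCommGroup E] [MeasurableSpace E] [BorelSpace E]
  {μ : Measure E} {U : Set E} {g : E → ℝ}

lemma integrable_mul_of_integrableOn_tsupport (hg : Continuous g) (hgc : HasCompactSupport g)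
    {f : E → ℝ} (hf : IntegrableOn f (tsupport g) μ) : Integrable (fun x => g x * f x) μ := by
  obtain ⟨C, hC⟩ := hgc.exists_bound_of_continuous hg
  have hsupp : Function.support (fun x => g x * f x) ⊆ tsupport g := fun x hx =>
    subset_tsupport g (left_ne_zero_of_mul hx)
  rw [← integrableOn_iff_integrable_of_support_subset hsupp]
  exact hf.bdd_mul hg.aestronglyMeasurable (Eventually.of_forall hC)

lemma tendsto_integral_mul_of_tendsto_setLIntegral (hg : Continuous g) (hgc : HasCompactSupport g)
    (hgU : tsupport g ⊆ U) (hU : MeasurableSet U) {f : ℕ → E → ℝ} {f₀ : E → ℝ}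
    (hf : ∀ n, IntegrableOn (f n) (tsupport g) μ) (hf₀ : IntegrableOn f₀ (tsupport g) μ)
    (hlim : Tendsto (fun n => ∫⁻ x in U, ‖f n x - f₀ x‖ₑ ∂μ) atTop (𝓝 0)) :
    Tendsto (fun n => ∫ x, g x * f n x ∂μ) atTop (𝓝 (∫ x, g x * f₀ x ∂μ)) := by
  obtain ⟨C, hC⟩ := hgc.exists_bound_of_continuous hg
  refine tendsto_integral_of_L1 _
    (integrable_mul_of_integrableOn_tsupport hg hgc hf₀).aestronglyMeasurable
    (Eventually.of_forall fun n => integrable_mul_of_integrableOn_tsupport hg hgc (hf n)) ?_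
  have h1 : Tendsto (fun n => ENNReal.ofReal C * ∫⁻ x in U, ‖f n x - f₀ x‖ₑ ∂μ) atTop (𝓝 0) := by
    simpa using ENNReal.Tendsto.const_mul hlim (Or.inr ENNReal.ofReal_ne_top)
  refine tendsto_of_tendsto_of_tendsto_of_le_of_le tendsto_const_nhds h1 (fun _ => zero_le)
    fun n => ?_
  dsimp only
  rw [← lintegral_const_mul' _ _ ENNReal.ofReal_ne_top, ← lintegral_indicator hU]
  refine lintegral_mono fun x => ?_
  by_cases hx : x ∈ U
  · rw [indicator_of_mem hx, ← mul_sub, enorm_mul]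
    gcongr
    rw [← ofReal_norm]
    exact ENNReal.ofReal_le_ofReal (hC x)
  · have : g x = 0 := image_eq_zero_of_notMem_tsupport fun h => hx (hgU h)
    simp [this]

variable [NormedSpace ℝ E] [FiniteDimensional ℝ E] [μ.IsAddHaarMeasure]

lemma LipschitzWith.integral_mul_fderiv_eq {v : E → ℝ} {K : ℝ≥0} (hv : LipschitzWith K v)
    (hg : ContDiff ℝ 1 g) (hgc : HasCompactSupport g) (e : E) :
    ∫ x, g x * fderiv ℝ v x e ∂μ = - ∫ x, fderiv ℝ g x e * v x ∂μ := by
  obtain ⟨C, hC⟩ := hg.lipschitzWith_of_hasCompactSupport hgc (by norm_num)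
  have h1 := hv.integral_lineDeriv_mul_eq (μ := μ) hC hgc e
  calc ∫ x, g x * fderiv ℝ v x e ∂μ = ∫ x, lineDeriv ℝ v x e * g x ∂μ := by
        refine integral_congr_ae ?_
        filter_upwards [hv.ae_differentiableAt (μ := μ)] with x hx
        rw [hx.lineDeriv_eq_fderiv, mul_comm]
    _ = ∫ x, lineDeriv ℝ g x (-e) * v x ∂μ := h1
    _ = ∫ x, -(fderiv ℝ g x e * v x) ∂μ := by
        refine integral_congr_ae (Eventually.of_forall fun x => ?_)
        dsimp only
        rw [((hg.differentiable (by norm_num)) x).lineDeriv_eq_fderiv, map_neg, neg_mul]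
    _ = _ := integral_neg _

/-- The distributional derivative of a Lipschitz limit is the limit of the derivatives. -/
lemma LipschitzWith.fderiv_ae_eq_of_tendsto (hU : IsOpen U) {u : ℕ → E → ℝ}
    (hu : ∀ n, ContDiffOn ℝ 1 (u n) U) {v : E → ℝ} {K : ℝ≥0} (hv : LipschitzWith K v)
    {N : E → ℝ} (hN : IntegrableOn N U μ) (e : E)
    (huv : Tendsto (fun n => ∫⁻ x in U, ‖u n x - v x‖ₑ ∂μ) atTop (𝓝 0))
    (huN : Tendsto (fun n => ∫⁻ x in U, ‖fderiv ℝ (u n) x e - N x‖ₑ ∂μ) atTop (𝓝 0)) :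
    ∀ᵐ x ∂(μ.restrict U), fderiv ℝ v x e = N x := by
  have hv' : LocallyIntegrable (fun x => fderiv ℝ v x e) μ := by
    refine (locallyIntegrable_const ((K : ℝ) * ‖e‖)).mono
      (measurable_fderiv_apply_const ℝ v e).aestronglyMeasurable (Eventually.of_forall fun x => ?_)
    exact ((ContinuousLinearMap.le_opNorm _ _).trans (mul_le_mul_of_nonneg_right
      (norm_fderiv_le_of_lipschitz ℝ hv) (norm_nonneg e))).trans (Real.le_norm_self _)
  have key := hU.ae_eq_zero_of_integral_contDiff_smul_eq_zero (μ := μ)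
    (f := fun x => fderiv ℝ v x e - N x)
    (hv'.locallyIntegrableOn U |>.sub hN.locallyIntegrableOn) fun g hg hgc hgU => by
      have hg1 : ContDiff ℝ 1 g := hg.of_le (by exact_mod_cast le_top)
      have hgcont := hg.continuous
      have hKc : IsCompact (tsupport g) := hgc
      have hdc : Continuous fun x => fderiv ℝ g x e :=
        (hg1.continuous_fderiv (by norm_num)).clm_apply continuous_const
      have hdsub : tsupport (fun x => fderiv ℝ g x e) ⊆ tsupport g :=
        tsupport_fderiv_apply_subset ℝ e
      have hdcs : HasCompactSupport fun x => fderiv ℝ g x e := hgc.fderiv_apply ℝ e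
      have hun : ∀ n, IntegrableOn (u n) (tsupport g) μ := fun n =>
        ((hu n).continuousOn.mono hgU).integrableOn_compact hKc
      have hun' : ∀ n, IntegrableOn (fun x => fderiv ℝ (u n) x e) (tsupport g) μ := fun n =>
        ((((hu n).continuousOn_fderiv_of_isOpen hU (by norm_num)).clm_apply
          continuousOn_const).mono hgU).integrableOn_compact hKc
      have hvi : IntegrableOn v (tsupport g) μ :=
        hv.continuous.continuousOn.integrableOn_compact hKc
      have hNi : IntegrableOn N (tsupport g) μ := hN.mono_set hgU
      have hvi' : IntegrableOn (fun x => fderiv ℝ v x e) (tsupport g) μ :=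
        hv'.integrableOn_isCompact hKc
      have l1 := tendsto_integral_mul_of_tendsto_setLIntegral hgcont hgc hgU hU.measurableSet
        hun' hNi huN
      have l2 := tendsto_integral_mul_of_tendsto_setLIntegral hdc hdcs (hdsub.trans hgU)
        hU.measurableSet (fun n => (hun n).mono_set hdsub) (hvi.mono_set hdsub) huv
      have hparts : ∀ n, ∫ x, g x * fderiv ℝ (u n) x e ∂μ = - ∫ x, fderiv ℝ g x e * u n x ∂μ :=
        fun n => integral_mul_fderiv_eq_neg_fderiv_mul_of_integrable
          (integrable_mul_of_integrableOn_tsupport hdc hdcs ((hun n).mono_set hdsub))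
          (integrable_mul_of_integrableOn_tsupport hgcont hgc (hun' n))
          (integrable_mul_of_integrableOn_tsupport hgcont hgc (hun n))
          (fun x _ => hg1.differentiable (by norm_num) x)
          (fun x hx => ((hu n).contDiffAt (hU.mem_nhds (hgU hx))).differentiableAt (by norm_num))
      simp only [hparts] at l1
      have h3 := tendsto_nhds_unique l1 l2.neg
      rw [← hv.integral_mul_fderiv_eq hg1 hgc e] at h3
      simp only [smul_eq_mul, mul_sub]
      rw [integral_sub (integrable_mul_of_integrableOn_tsupport hgcont hgc hvi')
        (integrable_mul_of_integrableOn_tsupport hgcont hgc hNi), h3, sub_self]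
  rw [ae_restrict_iff' hU.measurableSet]
  filter_upwards [key] with x hx hxU
  exact sub_eq_zero.1 (hx hxU)

end WeakDerivative

section LimitDeformation

lemma lipschitzWith_planar : LipschitzWith 1 fun x : Pt => (x.1, x.2.1) := by
  refine LipschitzWith.of_dist_le_mul fun x y => ?_
  simp only [NNReal.coe_one, one_mul, Prod.dist_eq]
  exact max_le_max le_rfl (le_max_left _ _)

lemma tendsto_lintegral_of_tendsto_lintegral_rpow {α : Type*} [MeasurableSpace α] {μ : Measure α}
    [IsFiniteMeasure μ] {p : ℝ} (hp : 1 ≤ p) {f : ℕ → α → ℝ≥0∞} (hf : ∀ n, AEMeasurable (f n) μ)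
    (h : Tendsto (fun n => ∫⁻ x, f n x ^ p ∂μ) atTop (𝓝 0)) :
    Tendsto (fun n => ∫⁻ x, f n x ∂μ) atTop (𝓝 0) := by
  have hp0 : 0 < p := by linarith
  have hle : ∀ n, ∫⁻ x, f n x ∂μ ≤ (∫⁻ x, f n x ^ p ∂μ) ^ (1 / p) * μ univ ^ (1 - 1 / p) := by
    intro n
    have := eLpNorm'_le_eLpNorm'_mul_rpow_measure_univ (f := f n) (μ := μ) one_pos hp
      (hf n).aestronglyMeasurable
    simpa [eLpNorm'] using this
  have hpow : Tendsto (fun n => (∫⁻ x, f n x ^ p ∂μ) ^ (1 / p)) atTop (𝓝 0) := by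
    simpa [hp0] using h.ennrpow_const (1 / p)
  have hlim : Tendsto (fun n => (∫⁻ x, f n x ^ p ∂μ) ^ (1 / p) * μ univ ^ (1 - 1 / p))
      atTop (𝓝 0) := by
    have hne : μ univ ^ (1 - 1 / p) ≠ ∞ := ENNReal.rpow_ne_top_of_nonneg
      (by rw [sub_nonneg, div_le_one hp0]; exact hp) (measure_ne_top μ univ)
    simpa using ENNReal.Tendsto.mul_const hpow (Or.inr hne)
  exact tendsto_of_tendsto_of_tendsto_of_le_of_le tendsto_const_nhds hlim (fun _ => zero_le) hle

lemma enorm_fderiv_sub_planar_le (u : Pt → V3) (z w : Pt) (M : M33) {h c : ℝ} (hh : 0 < h)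
    (hh1 : h ≤ 1) (hM : ‖M‖ ≤ c) :
    ‖fderiv ℝ u z w - (w.1 • M 0 + w.2.1 • M 1)‖ₑ ≤
      ‖w‖ₑ * (3 * ENNReal.ofReal (mnorm (gradh h u z - M)) + ENNReal.ofReal (h * c)) := by
  set D := gradh h u z - M with hD
  have hc : 0 ≤ c := (norm_nonneg M).trans hM
  have hDj : ∀ j, ‖D j‖ ≤ mnorm D := fun j => (norm_le_pi_norm D j).trans (norm_le_mnorm D)
  have hM2 : ‖M 2‖ ≤ c := (norm_le_pi_norm M 2).trans hM
  have hw1 : ‖w.1‖ ≤ ‖w‖ := norm_fst_le w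
  have hw2 : ‖w.2.1‖ ≤ ‖w‖ := (norm_fst_le w.2).trans (norm_snd_le w)
  have hw3 : ‖w.2.2‖ ≤ ‖w‖ := (norm_snd_le w.2).trans (norm_snd_le w)
  have hm := mnorm_nonneg D
  have heq : fderiv ℝ u z w - (w.1 • M 0 + w.2.1 • M 1) =
      w.1 • D 0 + w.2.1 • D 1 + (w.2.2 * h) • (D 2 + M 2) := by
    have h2 : D 2 + M 2 = h⁻¹ • pd e3 u z :=
      sub_add_cancel (h⁻¹ • pd e3 u z) (M 2)
    have h0 : D 0 = pd e1 u z - M 0 := rfl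
    have h1 : D 1 = pd e2 u z - M 1 := rfl
    rw [h2, h0, h1, fderiv_apply_eq_sum_pd, smul_smul, mul_assoc, mul_inv_cancel₀ hh.ne', mul_one,
      smul_sub, smul_sub]
    abel
  have hreal : ‖fderiv ℝ u z w - (w.1 • M 0 + w.2.1 • M 1)‖ ≤
      ‖w‖ * (3 * mnorm D + h * c) := by
    rw [heq]
    have t1 : ‖w.1 • D 0‖ ≤ ‖w‖ * mnorm D := by
      rw [norm_smul]; exact mul_le_mul hw1 (hDj 0) (norm_nonneg _) (norm_nonneg _)
    have t2 : ‖w.2.1 • D 1‖ ≤ ‖w‖ * mnorm D := by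
      rw [norm_smul]; exact mul_le_mul hw2 (hDj 1) (norm_nonneg _) (norm_nonneg _)
    have t3 : ‖(w.2.2 * h) • (D 2 + M 2)‖ ≤ ‖w‖ * (mnorm D + h * c) := by
      rw [norm_smul, norm_mul, Real.norm_of_nonneg hh.le, mul_assoc]
      refine mul_le_mul hw3 ?_ (by positivity) (norm_nonneg _)
      calc h * ‖D 2 + M 2‖ ≤ h * (mnorm D + c) := by
            gcongr; exact (norm_add_le _ _).trans (add_le_add (hDj 2) hM2)
        _ ≤ mnorm D + h * c := by nlinarith
    calc _ ≤ ‖w‖ * mnorm D + ‖w‖ * mnorm D + ‖w‖ * (mnorm D + h * c) :=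
          norm_add₃_le.trans (add_le_add (add_le_add t1 t2) t3)
      _ = _ := by ring
  rw [← ofReal_norm, ← ofReal_norm, ← ENNReal.ofReal_ofNat 3, ← ENNReal.ofReal_mul (by norm_num),
    ← ENNReal.ofReal_add (by positivity) (by positivity), ← ENNReal.ofReal_mul (norm_nonneg _)]
  exact ENNReal.ofReal_le_ofReal hreal

/-- A sequence of deformations whose rescaled gradients converge strongly to a bounded field
independent of the thickness variable converges, up to translations, to a planar Lipschitz map. -/
lemma exists_lipschitz_limit {p : ℝ} (hp : 1 ≤ p) {ω : Set (ℝ × ℝ)} (hωo : IsOpen ω)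
    (hωc : Convex ℝ ω) (hωb : Bornology.IsBounded ω) {h : ℕ → ℝ} (hh : ∀ n, 0 < h n)
    (hh1 : ∀ n, h n ≤ 1) (hh0 : Tendsto h atTop (𝓝 0)) {u : ℕ → Pt → V3}
    (hu : ∀ n, ContDiffOn ℝ 1 (u n) (Om ω)) {M : Pt → M33} (hM : Measurable M) {c : ℝ≥0}
    (hMc : ∀ x, ‖M x‖ ≤ c)
    (hfin : ∀ n, ∫⁻ x in Om ω, ENNReal.ofReal (mnorm (gradh (h n) (u n) x - M x) ^ p) ≠ ∞)
    (hlim : Tendsto (fun n => ∫⁻ x in Om ω,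
      ENNReal.ofReal (mnorm (gradh (h n) (u n) x - M x) ^ p)) atTop (𝓝 0)) :
    ∃ φ : ℕ → ℕ, StrictMono φ ∧ ∃ (v : ℝ × ℝ → V3) (K : ℝ≥0), LipschitzWith K v ∧
      (∀ᵐ x ∂(volume.restrict (Om ω)), pd e1 (fun y => v (y.1, y.2.1)) x = M x 0 ∧
        pd e2 (fun y => v (y.1, y.2.1)) x = M x 1) ∧
      Tendsto (fun n => ∫⁻ x in Om ω, ‖u (φ n) x - (⨍ y in Om ω, u (φ n) y) -
        v (x.1, x.2.1)‖ₑ ^ p) atTop (𝓝 0) := by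
  have hp0 : 0 < p := by linarith
  have hp1 : 1 ≤ ENNReal.ofReal p := by
    rw [← ENNReal.ofReal_one]; exact ENNReal.ofReal_le_ofReal hp
  have hUo := isOpen_Om hωo
  have hUc := convex_Om hωc
  have hUfin := volume_Om_ne_top hωb
  set μ := volume.restrict (Om ω) with hμ
  have hμfin : IsFiniteMeasure μ := ⟨by simpa [μ] using hUfin.lt_top⟩
  obtain ⟨R, hR, hRU⟩ := exists_norm_le_of_mem_Om hωb
  have hUR : ∀ x ∈ Om ω, ∀ y ∈ Om ω, ‖y - x‖ₑ ≤ ENNReal.ofReal (R + R) := fun x hx y hy => by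
    rw [← ofReal_norm]
    exact ENNReal.ofReal_le_ofReal ((norm_sub_le _ _).trans (add_le_add (hRU y hy) (hRU x hx)))
  set N : Pt → Pt → V3 := fun z w => w.1 • M z 0 + w.2.1 • M z 1 with hN
  have hNpl : ∀ z w, ‖N z w‖ ≤ (2 * c : ℝ≥0) * ‖(w.1, w.2.1)‖ := fun z w => by
    have k1 : ‖M z 0‖ ≤ c := (norm_le_pi_norm (M z) 0).trans (hMc z)
    have k2 : ‖M z 1‖ ≤ c := (norm_le_pi_norm (M z) 1).trans (hMc z)
    have l1 : ‖w.1‖ ≤ ‖(w.1, w.2.1)‖ := norm_fst_le (w.1, w.2.1)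
    have l2 : ‖w.2.1‖ ≤ ‖(w.1, w.2.1)‖ := norm_snd_le (w.1, w.2.1)
    calc ‖N z w‖ ≤ ‖w.1‖ * ‖M z 0‖ + ‖w.2.1‖ * ‖M z 1‖ := by
          rw [← norm_smul, ← norm_smul]; exact norm_add_le _ _
      _ ≤ ‖(w.1, w.2.1)‖ * c + ‖(w.1, w.2.1)‖ * c := by gcongr
      _ = _ := by push_cast; ring
  have hNe : ∀ z w, ‖N z w‖ₑ ≤ ENNReal.ofReal ((2 * c : ℝ≥0) * ‖(w.1, w.2.1)‖) := fun z w => by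
    rw [← ofReal_norm]; exact ENNReal.ofReal_le_ofReal (hNpl z w)
  have hNL : ∀ z w, ‖N z w‖ₑ ≤ ((2 * c : ℝ≥0) : ℝ≥0∞) * ‖w‖ₑ := fun z w => by
    refine (hNe z w).trans ?_
    rw [ENNReal.ofReal_mul (NNReal.coe_nonneg _), ENNReal.ofReal_coe_nnreal, ← ofReal_norm]
    gcongr
    exact max_le (norm_fst_le w) ((norm_fst_le w.2).trans (norm_snd_le w))
  set Z : ℕ → Pt → ℝ≥0∞ := fun n z =>
    3 * ENNReal.ofReal (mnorm (gradh (h n) (u n) z - M z)) + ENNReal.ofReal (h n * c) with hZ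
  have hG : ∀ n, Measurable fun z => mnorm (gradh (h n) (u n) z - M z) := fun n =>
    continuous_mnorm.measurable.comp ((measurable_gradh _ _).sub hM)
  have hZm : ∀ n, Measurable (Z n) := fun n =>
    ((hG n).ennreal_ofReal.const_mul 3).add_const _
  have huZ : ∀ n, ∀ z ∈ Om ω, ∀ w, ‖fderiv ℝ (u n) z w - N z w‖ₑ ≤ ‖w‖ₑ * Z n z :=
    fun n z _ w => enorm_fderiv_sub_planar_le (u n) z w (M z) (hh n) (hh1 n) (hMc z)
  set b : ℕ → ℝ≥0∞ := fun n => 2 ^ p * (3 ^ p *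
    (∫⁻ x, ENNReal.ofReal (mnorm (gradh (h n) (u n) x - M x) ^ p) ∂μ) +
      ENNReal.ofReal (h n * c) ^ p * μ univ) with hb
  have h2p : (2 : ℝ≥0∞) ^ p ≠ ∞ := ENNReal.rpow_ne_top_of_nonneg hp0.le (by simp)
  have h3p : (3 : ℝ≥0∞) ^ p ≠ ∞ := ENNReal.rpow_ne_top_of_nonneg hp0.le (by simp)
  have hZb : ∀ n, ∫⁻ x, Z n x ^ p ∂μ ≤ b n := fun n => by
    calc ∫⁻ x, Z n x ^ p ∂μ ≤ ∫⁻ x, 2 ^ p * (3 ^ p * ENNReal.ofReal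
          (mnorm (gradh (h n) (u n) x - M x) ^ p) + ENNReal.ofReal (h n * c) ^ p) ∂μ := by
          refine lintegral_mono fun x => (add_rpow_le_two_rpow hp0.le _ _).trans_eq ?_
          rw [ENNReal.mul_rpow_of_nonneg _ _ hp0.le,
            ENNReal.ofReal_rpow_of_nonneg (mnorm_nonneg _) hp0.le]
      _ = b n := by
          rw [lintegral_const_mul' _ _ h2p, lintegral_add_right _ measurable_const,
            lintegral_const_mul' _ _ h3p, lintegral_const]
  have hZfin : ∀ n, ∫⁻ x in Om ω, Z n x ^ p ≠ ∞ := fun n => by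
    refine ne_top_of_le_ne_top ?_ (hZb n)
    exact ENNReal.mul_ne_top h2p (ENNReal.add_ne_top.2 ⟨ENNReal.mul_ne_top h3p (hfin n),
      ENNReal.mul_ne_top (ENNReal.rpow_ne_top_of_nonneg hp0.le ENNReal.ofReal_ne_top)
        (measure_ne_top μ univ)⟩)
  have hZ0 : Tendsto (fun n => ∫⁻ x in Om ω, Z n x ^ p) atTop (𝓝 0) := by
    have k1 : Tendsto (fun n => ENNReal.ofReal (h n * c) ^ p) atTop (𝓝 0) := by
      have := (ENNReal.tendsto_ofReal (hh0.mul_const (c : ℝ))).ennrpow_const p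
      simpa [hp0] using this
    have hb0 : Tendsto b atTop (𝓝 0) := by
      have := ENNReal.Tendsto.const_mul (a := 2 ^ p) ((ENNReal.Tendsto.const_mul (a := 3 ^ p) hlim
        (Or.inr h3p)).add (ENNReal.Tendsto.mul_const k1 (Or.inr (measure_ne_top μ univ))))
          (Or.inr h2p)
      simpa using this
    exact tendsto_of_tendsto_of_tendsto_of_le_of_le tendsto_const_nhds hb0 (fun _ => zero_le) hZb
  have hZ1 : Tendsto (fun n => ∫⁻ x in Om ω, Z n x) atTop (𝓝 0) :=
    tendsto_lintegral_of_tendsto_lintegral_rpow hp (fun n => (hZm n).aemeasurable) hZ0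
  obtain ⟨hmem, w, hw, hwlim⟩ := exists_tendsto_sub_average volume hp hUo hUc hUfin
    ENNReal.ofReal_ne_top hUR hu ENNReal.coe_ne_top hNL hZm huZ hZfin hZ0
  set U : ℕ → Pt → V3 := fun n x => u n x - ⨍ y in Om ω, u n y with hU
  have hUmem : ∀ n, MemLp (U n) (ENNReal.ofReal p) μ := fun n => (hmem n).sub (memLp_const _)
  have hUdiff : ∀ n, ContDiffOn ℝ 1 (U n) (Om ω) := fun n => (hu n).sub contDiffOn_const
  have hUfd : ∀ n x, fderiv ℝ (U n) x = fderiv ℝ (u n) x := fun n x => fderiv_sub_const _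
  obtain ⟨φ, hφ, hae⟩ := (tendstoInMeasure_of_tendsto_eLpNorm (by simpa using hp0)
    (fun n => (hUmem n).aestronglyMeasurable) hw.aestronglyMeasurable hwlim).exists_seq_tendsto_ae
  have hlip := ae_ae_enorm_sub_le_of_tendsto volume hUo hUc hUfin ENNReal.ofReal_ne_top hUR
    (fun n => hUdiff (φ n)) hNe (fun n => hZm (φ n))
    (fun n z hz y => by rw [hUfd]; exact huZ (φ n) z hz y) (hZ1.comp hφ.tendsto_atTop) hae
  obtain ⟨v, hv, hwv⟩ := exists_lipschitz_planar_ae_eq (L := 2 * c) hωo (w := w) <| by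
    filter_upwards [hlip] with x hx
    filter_upwards [hx] with y hy
    rw [← ofReal_norm] at hy
    exact (ENNReal.ofReal_le_ofReal_iff (by positivity)).1 hy
  set v' : Pt → V3 := fun y => v (y.1, y.2.1) with hv'
  have hvLip : LipschitzWith (2 * c) v' := by
    have := hv.comp lipschitzWith_planar
    rwa [mul_one] at this
  have hUlim : Tendsto (fun n => ∫⁻ x, ‖U n x - v' x‖ₑ ^ p ∂μ) atTop (𝓝 0) := by
    have k := hwlim.ennrpow_const p
    rw [ENNReal.zero_rpow_of_pos hp0] at k
    refine k.congr fun n => ?_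
    rw [eLpNorm_ofReal_eq hp0, ← ENNReal.rpow_mul, one_div_mul_cancel hp0.ne', ENNReal.rpow_one]
    refine lintegral_congr_ae ?_
    filter_upwards [hwv] with x hx
    simp only [Pi.sub_apply, hx, hU, hv']
  refine ⟨φ, hφ, v, 2 * c, hv, ?_, hUlim.comp hφ.tendsto_atTop⟩
  have hUlim1 : Tendsto (fun n => ∫⁻ x, ‖U n x - v' x‖ₑ ∂μ) atTop (𝓝 0) :=
    tendsto_lintegral_of_tendsto_lintegral_rpow hp (fun n => ((hUmem n).aestronglyMeasurable.sub
      hvLip.continuous.aestronglyMeasurable).enorm) hUlim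
  have hcomp : ∀ (f : Pt → V3) (i : Fin 3) (x : Pt), DifferentiableAt ℝ f x → ∀ e,
      fderiv ℝ (fun y => f y i) x e = fderiv ℝ f x e i := fun f i x hf e => by
    rw [fderiv_apply hf]; rfl
  have hNm : ∀ e, Measurable fun z => N z e := fun e =>
    (((measurable_pi_apply 0).comp hM).const_smul e.1).add
      (((measurable_pi_apply 1).comp hM).const_smul e.2.1)
  have key : ∀ e : Pt, ∀ᵐ x ∂μ, fderiv ℝ v' x e = N x e := fun e => by
    have hi : ∀ i : Fin 3, ∀ᵐ x ∂μ, fderiv ℝ (fun y => v' y i) x e = N x e i := fun i => by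
      have hproj : LipschitzWith 1 fun y : V3 => y i := LipschitzWith.eval i
      refine (hproj.comp hvLip).fderiv_ae_eq_of_tendsto (u := fun n x => U n x i) hUo
        (fun n => contDiffOn_pi.1 (hUdiff n) i) ?_ e ?_ ?_
      · refine Measure.integrableOn_of_bounded hUfin
          ((measurable_pi_apply i).comp (hNm e)).aestronglyMeasurable
          (M := (2 * c : ℝ≥0) * ‖(e.1, e.2.1)‖)
          (Eventually.of_forall fun x => (norm_le_pi_norm (N x e) i).trans (hNpl x e))
      · refine tendsto_of_tendsto_of_tendsto_of_le_of_le tendsto_const_nhds hUlim1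
          (fun _ => zero_le) fun n => lintegral_mono fun x => ?_
        exact enorm_le_iff_norm_le.2 (norm_le_pi_norm (U n x - v' x) i)
      · have k : Tendsto (fun n => ‖e‖ₑ * ∫⁻ x, Z n x ∂μ) atTop (𝓝 0) := by
          simpa using ENNReal.Tendsto.const_mul hZ1 (Or.inr enorm_ne_top)
        refine tendsto_of_tendsto_of_tendsto_of_le_of_le tendsto_const_nhds k
          (fun _ => zero_le) fun n => ?_
        dsimp only
        rw [← lintegral_const_mul' _ _ enorm_ne_top]
        refine setLIntegral_mono' hUo.measurableSet fun x hx => ?_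
        have hd : DifferentiableAt ℝ (U n) x :=
          ((hUdiff n).contDiffAt (hUo.mem_nhds hx)).differentiableAt (by norm_num)
        rw [hcomp (U n) i x hd, hUfd]
        refine le_trans ?_ (huZ n x hx e)
        exact enorm_le_iff_norm_le.2 (norm_le_pi_norm (fderiv ℝ (u n) x e - N x e) i)
    filter_upwards [ae_all_iff.2 hi, ae_restrict_of_ae hvLip.ae_differentiableAt] with x hx hd
    ext i
    rw [← hx i, hcomp v' i x hd]
  filter_upwards [key e1, key e2] with x hx1 hx2
  refine ⟨hx1.trans ?_, hx2.trans ?_⟩ <;> simp [hN, e1, e2]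

end LimitDeformation

/-- Theorem 1.1, Compactness; BV regularity of the limit omitted. -/
theorem statement3 (p : ℝ) (hp : 2 ≤ p) (A B : M33) (W : M33 → ℝ)
    (hWc : Continuous W) (h1 : H1 W A B) (h2 : H2 W p)
    (ω : Set (ℝ × ℝ)) (hωo : IsOpen ω) (hωc : Convex ℝ ω)
    (hωb : Bornology.IsBounded ω) (hωne : ω.Nonempty)
    (h ε : ℕ → ℝ) (hh : ∀ n, 0 < h n) (hε : ∀ n, 0 < ε n)
    (hh0 : Tendsto h atTop (nhds 0)) (hε0 : Tendsto ε atTop (nhds 0))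
    (u : ℕ → Pt → V3) (hu : ∀ n, ContDiffOn ℝ 2 (u n) (Om ω))
    (hbd : ∃ C : ℝ≥0∞, C < ⊤ ∧ ∀ n, F W (h n) (ε n) (u n) (Om ω) ≤ C) :
    ∃ φ : ℕ → ℕ, StrictMono φ ∧
    ∃ E : Set (ℝ × ℝ), MeasurableSet E ∧ E ⊆ ω ∧
    ∃ (v : Pt → V3) (K : ℝ≥0), LipschitzOnWith K v (Om ω) ∧
      (∀ x₁ x₂ t t', v (x₁, x₂, t) = v (x₁, x₂, t')) ∧
      (∀ᵐ x ∂(volume.restrict (Om ω)),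
        pd e1 v x = Mfun A B E (x.1, x.2.1) 0 ∧ pd e2 v x = Mfun A B E (x.1, x.2.1) 1) ∧
      Tendsto (fun n => ∫⁻ x in Om ω, ENNReal.ofReal
          ((mnorm (gradh (h (φ n)) (u (φ n)) x - Mfun A B E (x.1, x.2.1))) ^ p))
        atTop (nhds 0) ∧
      Tendsto (fun n => ∫⁻ x in Om ω, ENNReal.ofReal
          ((vnorm (u (φ n) x - (volume (Om ω)).toReal⁻¹ • (∫ y in Om ω, u (φ n) y) - v x)) ^ p))
        atTop (nhds 0) := by
  obtain ⟨hW, hW0, hAB, -⟩ := h1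
  obtain ⟨C, hC, hgrowth⟩ := h2
  obtain ⟨K, hK, hF⟩ := hbd
  have hp0 : 0 < p := by linarith
  obtain ⟨φ, hφ, E, hE, hEω, hlim⟩ := exists_subseq_gradh_tendsto (by linarith) hWc hW hW0 hAB hC
    (fun ξ => (hgrowth ξ).1) hωo hωc hωb hh hε hh0 hε0 hu hK.ne hF
  obtain ⟨m, hm⟩ := eventually_atTop.1 ((hlim.eventually_lt_const zero_lt_one).and
    ((hh0.comp hφ.tendsto_atTop).eventually_le_const zero_lt_one))
  have hφm : StrictMono fun n => φ (n + m) := hφ.comp (strictMono_id.add_const m)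
  have hlim_m := (tendsto_add_atTop_iff_nat m).2 hlim
  obtain ⟨ψ, hψ, v, L, hv, hpd, hvlim⟩ := exists_lipschitz_limit (p := p) (by linarith) hωo hωc hωb
    (h := fun n => h (φ (n + m))) (fun n => hh _) (fun n => (hm (n + m) le_add_self).2)
    (hh0.comp hφm.tendsto_atTop) (u := fun n => u (φ (n + m)))
    (fun n => (hu _).of_le (by norm_num)) (M := fun x => Mfun A B E (x.1, x.2.1))
    ((measurable_Mfun hE).comp measurable_planar) (c := max ‖A‖₊ ‖B‖₊)
    (fun x => norm_Mfun_le A B E _)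
    (fun n => ((hm (n + m) le_add_self).1.trans ENNReal.one_lt_top).ne) hlim_m
  have hvLip : LipschitzWith L fun x : Pt => v (x.1, x.2.1) := by
    have := hv.comp lipschitzWith_planar
    rwa [mul_one] at this
  refine ⟨fun n => φ (ψ n + m), hφm.comp hψ, E, hE, hEω, fun x => v (x.1, x.2.1), L,
    hvLip.lipschitzOnWith, fun _ _ _ _ => rfl, hpd, hlim_m.comp hψ.tendsto_atTop, ?_⟩
  have h3p : (3 : ℝ≥0∞) ^ p ≠ ∞ := ENNReal.rpow_ne_top_of_nonneg hp0.le (by simp)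
  have hbound : Tendsto (fun n => 3 ^ p * ∫⁻ x in Om ω, ‖u (φ (ψ n + m)) x -
      (⨍ y in Om ω, u (φ (ψ n + m)) y) - v (x.1, x.2.1)‖ₑ ^ p) atTop (𝓝 0) := by
    simpa using ENNReal.Tendsto.const_mul hvlim (Or.inr h3p)
  refine tendsto_of_tendsto_of_tendsto_of_le_of_le tendsto_const_nhds hbound (fun _ => zero_le)
    fun n => ?_
  dsimp only
  rw [← lintegral_const_mul' _ _ h3p]
  refine lintegral_mono fun x => ?_
  rw [← ENNReal.mul_rpow_of_nonneg _ _ hp0.le,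
    ← ENNReal.ofReal_rpow_of_nonneg (vnorm_nonneg _) hp0.le, setAverage_eq, Measure.real]
  gcongr
  refine (ENNReal.ofReal_le_ofReal (vnorm_le_norm _)).trans_eq ?_
  rw [ENNReal.ofReal_mul (by norm_num), ofReal_norm, ENNReal.ofReal_ofNat]
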